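/- Each of the Priorean temporal logics Lin, Lin_Q and Lin_R has the polysize bisimilar model property: for each such L there is a polynomial function P : ℕ → ℕ such that, whenever temporal formulas φ₁ and φ₂ have no interpolant in L, there exist, for σ := sig(φ₁)∩sig(φ₂), temporal models M₁,x₁ and M₂,x₂ based on temporal Kripke frames for L with at most P(max(|φ₁|,|φ₂|)) points each, such that M₁,x₁ ⊨ φ₁, M₂,x₂ ⊨ ¬φ₂ and M₁,x₁ ∼_σ M₂,x₂. -/

import Mathlib

/-! ## Priorean temporal formulas -/

inductive TMF : Type
  | var : ℕ → TMF
  | top : TMF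
  | bot : TMF
  | neg : TMF → TMF
  | and : TMF → TMF → TMF
  | diaF : TMF → TMF
  | diaP : TMF → TMF
deriving DecidableEq

namespace TMF

def or (φ ψ : TMF) : TMF := .neg (.and (.neg φ) (.neg ψ))
def imp (φ ψ : TMF) : TMF := TMF.or (.neg φ) ψ
def boxF (φ : TMF) : TMF := .neg (.diaF (.neg φ))
def boxP (φ : TMF) : TMF := .neg (.diaP (.neg φ))

def vars : TMF → Finset ℕ
  | .var p => {p}
  | .top => ∅
  | .bot => ∅
  | .neg φ => vars φ
  | .and φ ψ => vars φ ∪ vars ψ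
  | .diaF φ => vars φ
  | .diaP φ => vars φ

def sig (φ : TMF) : Set ℕ := ↑(vars φ)

def subs : TMF → Finset TMF
  | .var p => {.var p}
  | .top => {.top}
  | .bot => {.bot}
  | .neg φ => insert (.neg φ) (subs φ)
  | .and φ ψ => insert (.and φ ψ) (subs φ ∪ subs ψ)
  | .diaF φ => insert (.diaF φ) (subs φ)
  | .diaP φ => insert (.diaP φ) (subs φ)

/-- `|φ|`: the number of subformulas of `φ` together with their negations -/
def size (φ : TMF) : ℕ := ((subs φ) ∪ (subs φ).image TMF.neg).card

end TMF

/-! ## Temporal frames and models -/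

/-- a (general) temporal frame -/
structure TFrame (W : Type) where
  R : W → W → Prop
  P : Set (Set W)

namespace TFrame

variable {W : Type}

def diaF (F : TFrame W) (X : Set W) : Set W := {x | ∃ y ∈ X, F.R x y}
def diaP (F : TFrame W) (X : Set W) : Set W := {x | ∃ y ∈ X, F.R y x}

/-- the conditions making `F` a general temporal frame: the relation is transitive and
connected, and the internal sets are closed under the Booleans, `◇_F` and `◇_P` -/
def IsGeneral (F : TFrame W) : Prop :=
  Nonempty W ∧ Transitive F.R ∧ (∀ x y : W, F.R x y ∨ x = y ∨ F.R y x) ∧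
  ∅ ∈ F.P ∧ Set.univ ∈ F.P ∧
  (∀ X ∈ F.P, ∀ Y ∈ F.P, X ∩ Y ∈ F.P) ∧ (∀ X ∈ F.P, Xᶜ ∈ F.P) ∧
  (∀ X ∈ F.P, F.diaF X ∈ F.P) ∧ (∀ X ∈ F.P, F.diaP X ∈ F.P)

/-- differentiated, tight and compact -/
def Descriptive (F : TFrame W) : Prop :=
  (∀ x y : W, (∀ X ∈ F.P, x ∈ X ↔ y ∈ X) → x = y) ∧
  (∀ x y : W, F.R x y ↔ ∀ X ∈ F.P, y ∈ X → x ∈ F.diaF X) ∧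
  (∀ 𝒳 : Set (Set W), 𝒳 ⊆ F.P →
    (∀ 𝒴 : Set (Set W), 𝒴 ⊆ 𝒳 → 𝒴.Finite → (⋂₀ 𝒴).Nonempty) → (⋂₀ 𝒳).Nonempty)

/-- the strict order on clusters -/
def clLT (F : TFrame W) (x y : W) : Prop := F.R x y ∧ ¬ F.R y x

/-- `F` has non-degenerate `R`-final and `R⁻`-final clusters -/
def Serial (F : TFrame W) : Prop :=
  (∃ x, (∀ y, ¬ F.clLT x y) ∧ F.R x x) ∧ (∃ x, (∀ y, ¬ F.clLT y x) ∧ F.R x x)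

/-- between any two distinct degenerate clusters there lies a non-degenerate cluster -/
def DenseFrm (F : TFrame W) : Prop :=
  ∀ x y, ¬ F.R x x → ¬ F.R y y → F.clLT x y → ∃ z, F.R z z ∧ F.clLT x z ∧ F.clLT z y

/-- between any two distinct non-degenerate clusters there lies a degenerate cluster -/
def DedekindComplete (F : TFrame W) : Prop :=
  ∀ x y, F.R x x → F.R y y → F.clLT x y → ∃ z, ¬ F.R z z ∧ F.clLT x z ∧ F.clLT z y

end TFrame

/-- the closure of a family of sets under `∩`, complement, `◇_F` and `◇_P` -/
inductive tgenBy {W : Type} (R : W → W → Prop) (G : Set (Set W)) : Set W → Prop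
  | basic {X : Set W} : X ∈ G → tgenBy R G X
  | empty : tgenBy R G ∅
  | univ : tgenBy R G Set.univ
  | inter {X Y : Set W} : tgenBy R G X → tgenBy R G Y → tgenBy R G (X ∩ Y)
  | compl {X : Set W} : tgenBy R G X → tgenBy R G Xᶜ
  | diaF {X : Set W} : tgenBy R G X → tgenBy R G {x | ∃ y ∈ X, R x y}
  | diaP {X : Set W} : tgenBy R G X → tgenBy R G {x | ∃ y ∈ X, R y x}

def TFrame.FinGenerated {W : Type} (F : TFrame W) : Prop :=
  ∃ G : Set (Set W), G.Finite ∧ F.P = {X | tgenBy F.R G X}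

/-- a temporal model -/
structure TModel (W : Type) where
  F : TFrame W
  v : ℕ → Set W

namespace TModel

variable {W : Type}

def IsModel (M : TModel W) : Prop := M.F.IsGeneral ∧ ∀ p, M.v p ∈ M.F.P

def sat (M : TModel W) : W → TMF → Prop
  | x, .var p => x ∈ M.v p
  | _, .top => True
  | _, .bot => False
  | x, .neg φ => ¬ sat M x φ
  | x, .and φ ψ => sat M x φ ∧ sat M x ψ
  | x, .diaF φ => ∃ y, M.F.R x y ∧ sat M y φ
  | x, .diaP φ => ∃ y, M.F.R y x ∧ sat M y φ

end TModel

def TFrame.Valid {W : Type} (F : TFrame W) (φ : TMF) : Prop :=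
  ∀ v : ℕ → Set W, (∀ p, v p ∈ F.P) → ∀ x, (TModel.mk F v).sat x φ

def TFrame.IsFrameFor {W : Type} (F : TFrame W) (L : Set TMF) : Prop :=
  ∀ φ ∈ L, F.Valid φ

/-- a temporal Kripke frame -/
def tKripke (W : Type) (R : W → W → Prop) : TFrame W := ⟨R, Set.univ⟩

/-! ## The standard temporal logics -/

/-- the logic of all temporal Kripke frames -/
def Lin : Set TMF :=
  {φ | ∀ (W : Type) (R : W → W → Prop), Nonempty W → Transitive R →
        (∀ x y : W, R x y ∨ x = y ∨ R y x) → (tKripke W R).Valid φ}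

def LinQ : Set TMF := {φ | (tKripke ℚ (· < ·)).Valid φ}
def LinR : Set TMF := {φ | (tKripke ℝ (· < ·)).Valid φ}
def LinZ : Set TMF := {φ | (tKripke ℤ (· < ·)).Valid φ}

/-- the logic of all finite strict linear orders -/
def LinFin : Set TMF :=
  {φ | ∀ (W : Type) (_ : Fintype W) (R : W → W → Prop),
        Nonempty W → IsStrictTotalOrder W R → (tKripke W R).Valid φ}

/-! ## Temporal bisimulations and interpolants -/

def TIsBisim {W₁ W₂ : Type} (σ : Set ℕ) (M₁ : TModel W₁) (M₂ : TModel W₂)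
    (β : W₁ → W₂ → Prop) : Prop :=
  ∀ x₁ x₂, β x₁ x₂ →
    (∀ p ∈ σ, x₁ ∈ M₁.v p ↔ x₂ ∈ M₂.v p) ∧
    (∀ y₁, M₁.F.R x₁ y₁ → ∃ y₂, M₂.F.R x₂ y₂ ∧ β y₁ y₂) ∧
    (∀ y₂, M₂.F.R x₂ y₂ → ∃ y₁, M₁.F.R x₁ y₁ ∧ β y₁ y₂) ∧
    (∀ y₁, M₁.F.R y₁ x₁ → ∃ y₂, M₂.F.R y₂ x₂ ∧ β y₁ y₂) ∧
    (∀ y₂, M₂.F.R y₂ x₂ → ∃ y₁, M₁.F.R y₁ x₁ ∧ β y₁ y₂)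

def TBisimilar {W₁ W₂ : Type} (σ : Set ℕ) (M₁ : TModel W₁) (x₁ : W₁)
    (M₂ : TModel W₂) (x₂ : W₂) : Prop :=
  ∃ β, TIsBisim σ M₁ M₂ β ∧ β x₁ x₂

def TIsInterpolant (L : Set TMF) (φ₁ φ₂ ι : TMF) : Prop :=
  ι.sig ⊆ φ₁.sig ∩ φ₂.sig ∧ TMF.imp φ₁ ι ∈ L ∧ TMF.imp ι φ₂ ∈ L

def TNoInterpolant (L : Set TMF) (φ₁ φ₂ : TMF) : Prop := ¬ ∃ ι, TIsInterpolant L φ₁ φ₂ ι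

/-! ## Canonical points of the logic of a class of Kripke frames -/

namespace TMF

/-- the diamond of the future (`true`) or of the past (`false`) -/
def dia : Bool → TMF → TMF
  | true, φ => .diaF φ
  | false, φ => .diaP φ

def conj : List TMF → TMF
  | [] => .top
  | φ :: l => .and φ (conj l)

/-- all variables of `φ` belong to `V` -/
def Over (V : Set ℕ) (φ : TMF) : Prop := φ.sig ⊆ V

variable {V : Set ℕ} {φ ψ : TMF}

lemma over_neg : Over V φ.neg ↔ Over V φ := Iff.rfl

lemma over_top : Over V .top := by simp [Over, sig, vars]

lemma over_and : Over V (.and φ ψ) ↔ Over V φ ∧ Over V ψ := by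
  simp [Over, sig, vars]

lemma over_dia {d : Bool} : Over V (dia d φ) ↔ Over V φ := by
  cases d <;> exact Iff.rfl

lemma over_conj {l : List TMF} (h : ∀ φ ∈ l, Over V φ) : Over V (conj l) := by
  induction l with
  | nil => exact over_top
  | cons φ l ih =>
    simp only [List.mem_cons, forall_eq_or_imp] at h
    exact over_and.2 ⟨h.1, ih h.2⟩

lemma over_univ : Over Set.univ φ := Set.subset_univ _

end TMF

section Canonical

open TMF

structure KFrame where
  W : Type
  R : W → W → Prop

/-- the accessibility relation read forwards (`true`) or backwards (`false`) -/
def KFrame.rel (F : KFrame) : Bool → F.W → F.W → Prop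
  | true, x, y => F.R x y
  | false, x, y => F.R y x

lemma KFrame.rel_not (F : KFrame) (d : Bool) (x y : F.W) : F.rel (!d) x y ↔ F.rel d y x := by
  cases d <;> exact Iff.rfl

structure KFrame.Linear (F : KFrame) : Prop where
  trans : ∀ ⦃x y z⦄, F.R x y → F.R y z → F.R x z
  conn : ∀ x y, F.R x y ∨ x = y ∨ F.R y x

lemma KFrame.Linear.rel_trans {F : KFrame} (h : F.Linear) (d : Bool) {x y z : F.W}
    (hxy : F.rel d x y) (hyz : F.rel d y z) : F.rel d x z := by
  cases d
  · exact h.trans hyz hxy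
  · exact h.trans hxy hyz

lemma KFrame.Linear.rel_conn {F : KFrame} (h : F.Linear) (d : Bool) (x y : F.W) :
    F.rel d x y ∨ x = y ∨ F.rel d y x := by
  cases d
  · rcases h.conn x y with h | h | h <;> simp [KFrame.rel, h]
  · exact h.conn x y

/-- the logic of a class of Kripke frames -/
def logicOf (𝒦 : Set KFrame) : Set TMF := {φ | ∀ F ∈ 𝒦, (tKripke F.W F.R).Valid φ}

/-- pointed models based on frames of a class -/
structure PModel (𝒦 : Set KFrame) where
  F : KFrame
  mem : F ∈ 𝒦
  v : ℕ → Set F.W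
  x : F.W

variable {𝒦 : Set KFrame} {V : Set ℕ}

def PModel.Holds (u : PModel 𝒦) (φ : TMF) : Prop :=
  (TModel.mk (tKripke u.F.W u.F.R) u.v).sat u.x φ

def PModel.move (u : PModel 𝒦) (y : u.F.W) : PModel 𝒦 := ⟨u.F, u.mem, u.v, y⟩

lemma PModel.holds_neg {u : PModel 𝒦} {φ : TMF} : u.Holds φ.neg ↔ ¬ u.Holds φ := Iff.rfl

lemma PModel.holds_and {u : PModel 𝒦} {φ ψ : TMF} :
    u.Holds (.and φ ψ) ↔ u.Holds φ ∧ u.Holds ψ := Iff.rfl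

lemma PModel.holds_top {u : PModel 𝒦} : u.Holds .top := trivial

lemma PModel.holds_dia {u : PModel 𝒦} {d : Bool} {φ : TMF} :
    u.Holds (dia d φ) ↔ ∃ y, u.F.rel d u.x y ∧ (u.move y).Holds φ := by
  cases d <;> exact Iff.rfl

lemma PModel.holds_conj {u : PModel 𝒦} {l : List TMF} :
    u.Holds (conj l) ↔ ∀ φ ∈ l, u.Holds φ := by
  induction l with
  | nil => simpa [conj] using PModel.holds_top
  | cons φ l ih => simp [conj, PModel.holds_and, ih]

lemma mem_logicOf {φ : TMF} : φ ∈ logicOf 𝒦 ↔ ∀ u : PModel 𝒦, u.Holds φ :=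
  ⟨fun h u => h u.F u.mem u.v (fun _ => Set.mem_univ _) u.x,
    fun h F hF v _ x => h ⟨F, hF, v, x⟩⟩

lemma PModel.holds_imp {u : PModel 𝒦} {φ ψ : TMF} :
    u.Holds (.imp φ ψ) ↔ (u.Holds φ → u.Holds ψ) := by
  simp [TMF.imp, TMF.or, PModel.holds_neg, PModel.holds_and]

/-- the ultrafilter limits of the `V`-theories of pointed models -/
def Pt (𝒦 : Set KFrame) (V : Set ℕ) : Type :=
  {x : Set TMF // ∃ 𝒰 : Ultrafilter (PModel 𝒦),
    ∀ φ, φ ∈ x ↔ Over V φ ∧ ∀ᶠ u in (𝒰 : Filter (PModel 𝒦)), u.Holds φ}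

namespace Pt

instance : Membership TMF (Pt 𝒦 V) := ⟨fun x φ => φ ∈ x.1⟩

variable {x y z : Pt 𝒦 V} {φ ψ : TMF}

lemma mem_over (h : φ ∈ x) : Over V φ := by
  obtain ⟨x, 𝒰, h𝒰⟩ := x
  exact ((h𝒰 φ).1 h).1

lemma mem_neg (hφ : Over V φ) : φ.neg ∈ x ↔ φ ∉ x := by
  obtain ⟨x, 𝒰, h𝒰⟩ := x
  change φ.neg ∈ x ↔ ¬ φ ∈ x
  rw [h𝒰, h𝒰]
  simp only [over_neg, hφ, true_and]
  exact Ultrafilter.eventually_not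

lemma exists_holds (l : List TMF) (hl : ∀ φ ∈ l, φ ∈ x) : ∃ u : PModel 𝒦, ∀ φ ∈ l, u.Holds φ := by
  obtain ⟨x, 𝒰, h𝒰⟩ := x
  have : ∀ᶠ u in (𝒰 : Filter (PModel 𝒦)), ∀ φ ∈ l, u.Holds φ := by
    have := (Filter.eventually_all_finite (l := (𝒰 : Filter (PModel 𝒦)))
      (p := fun φ u => u.Holds φ) (List.finite_toSet l)).2
      (fun φ hφ => ((h𝒰 φ).1 (hl φ hφ)).2)
    exact this
  exact this.exists

lemma mem_of_entails (l : List TMF) (hl : ∀ φ ∈ l, φ ∈ x) (hψ : Over V ψ)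
    (h : ∀ u : PModel 𝒦, (∀ φ ∈ l, u.Holds φ) → u.Holds ψ) : ψ ∈ x := by
  by_contra hn
  rw [← mem_neg hψ] at hn
  obtain ⟨u, hu⟩ := exists_holds (x := x) (ψ.neg :: l) (by simpa using ⟨hn, hl⟩)
  simp only [List.mem_cons, forall_eq_or_imp] at hu
  exact hu.1 (h u hu.2)

lemma mem_of_imp (hφ : φ ∈ x) (hψ : Over V ψ) (h : ∀ u : PModel 𝒦, u.Holds φ → u.Holds ψ) :
    ψ ∈ x :=
  mem_of_entails [φ] (by simpa using hφ) hψ (by simpa using h)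

lemma mem_and (hφ : Over V φ) (hψ : Over V ψ) : φ.and ψ ∈ x ↔ φ ∈ x ∧ ψ ∈ x :=
  ⟨fun h => ⟨mem_of_imp h hφ fun _ hu => hu.1, mem_of_imp h hψ fun _ hu => hu.2⟩,
    fun h => mem_of_entails [φ, ψ] (by simpa using h) (over_and.2 ⟨hφ, hψ⟩)
      (by simp +contextual [PModel.holds_and])⟩

lemma conj_mem {l : List TMF} (hl : ∀ φ ∈ l, φ ∈ x) : conj l ∈ x :=
  mem_of_entails l hl (over_conj fun φ h => mem_over (hl φ h)) fun _ => PModel.holds_conj.2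

lemma ext_of_subset (h : ∀ φ ∈ x, φ ∈ y) : x = y := by
  refine Subtype.ext (Set.ext fun φ => ⟨h φ, fun hy => ?_⟩)
  by_contra hx
  exact (mem_neg (mem_over (x := y) hy)).1 (h _ ((mem_neg (mem_over (x := y) hy)).2 hx)) hy

lemma exists_of_finSat {Γ : Set TMF} (hΓ : ∀ φ ∈ Γ, Over V φ)
    (h : ∀ l : List TMF, (∀ φ ∈ l, φ ∈ Γ) → ∃ u : PModel 𝒦, ∀ φ ∈ l, u.Holds φ) :
    ∃ x : Pt 𝒦 V, ∀ φ ∈ Γ, φ ∈ x := by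
  classical
  obtain ⟨𝒰, h𝒰⟩ := Ultrafilter.exists_ultrafilter_of_finite_inter_nonempty
    (Set.image (fun φ => {u : PModel 𝒦 | u.Holds φ}) Γ) (by
      intro T hT
      obtain ⟨l, hl, rfl⟩ := Finset.subset_set_image_iff.1 hT
      obtain ⟨u, hu⟩ := h l.toList (fun φ hφ => hl (by simpa using hφ))
      exact ⟨u, by simpa using hu⟩)
  exact ⟨⟨{φ | Over V φ ∧ ∀ᶠ u in (𝒰 : Filter (PModel 𝒦)), u.Holds φ}, 𝒰, fun _ => Iff.rfl⟩,
    fun φ hφ => ⟨hΓ φ hφ, h𝒰 ⟨φ, hφ, rfl⟩⟩⟩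

/-- canonical accessibility, forwards (`true`) or backwards (`false`) -/
def Rel (d : Bool) (x y : Pt 𝒦 V) : Prop := ∀ φ ∈ y, dia d φ ∈ x

lemma Rel.swap {d : Bool} (h : Rel d x y) : Rel (!d) y x := by
  intro φ hφ
  by_contra hn
  have hO : Over V (dia (!d) φ) := over_dia.2 (mem_over hφ)
  have h1 := h _ ((mem_neg hO).2 hn)
  obtain ⟨u, hu⟩ := exists_holds (x := x) [φ, dia d (dia (!d) φ).neg] (by simpa using ⟨hφ, h1⟩)
  simp only [List.mem_cons, forall_eq_or_imp, List.not_mem_nil, false_implies, implies_true,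
    and_true] at hu
  obtain ⟨w, hw, hw'⟩ := PModel.holds_dia.1 hu.2
  exact hw' (PModel.holds_dia.2 ⟨u.x, (u.F.rel_not d _ _).2 hw, hu.1⟩)

lemma rel_not {d : Bool} : Rel (!d) x y ↔ Rel d y x :=
  ⟨fun h => by simpa using h.swap, fun h => h.swap⟩

lemma exists_rel {d : Bool} {Γ : Set TMF}
    (h : ∀ l : List TMF, (∀ φ ∈ l, φ ∈ Γ) → dia d (conj l) ∈ x) :
    ∃ y, Rel d x y ∧ ∀ φ ∈ Γ, φ ∈ y := by
  have hΓ : ∀ φ ∈ Γ, Over V φ := fun φ hφ =>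
    (over_and.1 (over_dia.1 (mem_over (h [φ] (by simpa using hφ))))).1
  obtain ⟨y, hy⟩ := exists_of_finSat (𝒦 := 𝒦) (V := V)
    (Γ := Γ ∪ {φ | ∃ ψ, φ = ψ.neg ∧ Over V ψ ∧ dia d ψ ∉ x}) (by
      rintro φ (hφ | ⟨ψ, rfl, hψ, -⟩)
      · exact hΓ φ hφ
      · exact hψ) (by
      classical
      intro l hl
      let l₁ := l.filter (· ∈ Γ)
      let l₂ := (l.filter (· ∉ Γ)).map fun φ => match φ with
        | .neg ψ => (dia d ψ).neg
        | _ => .top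
      obtain ⟨u, hu⟩ := exists_holds (x := x) (dia d (conj l₁) :: l₂) (by
        simp only [List.mem_cons, forall_eq_or_imp]
        refine ⟨h l₁ (by simp [l₁]), ?_⟩
        intro χ hχ
        simp only [l₂, List.mem_map, List.mem_filter, decide_eq_true_eq] at hχ
        obtain ⟨φ, ⟨hφl, hφΓ⟩, rfl⟩ := hχ
        rcases hl φ hφl with hφ | ⟨ψ, rfl, hψ, hn⟩
        · exact absurd hφ hφΓ
        · exact (mem_neg (over_dia.2 hψ)).2 hn)
      simp only [List.mem_cons, forall_eq_or_imp] at hu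
      obtain ⟨w, hw, hw'⟩ := PModel.holds_dia.1 hu.1
      refine ⟨u.move w, fun φ hφ => ?_⟩
      by_cases hφΓ : φ ∈ Γ
      · exact PModel.holds_conj.1 hw' φ (by simp [l₁, hφ, hφΓ])
      · rcases hl φ hφ with hφ' | ⟨ψ, rfl, hψ, hn⟩
        · exact absurd hφ' hφΓ
        · intro hc
          refine hu.2 (dia d ψ).neg ?_ (PModel.holds_dia.2 ⟨w, hw, hc⟩)
          simp only [l₂, List.mem_map, List.mem_filter, decide_eq_true_eq]
          exact ⟨ψ.neg, ⟨hφ, hφΓ⟩, rfl⟩)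
  refine ⟨y, fun φ hφ => ?_, fun φ hφ => hy φ (Or.inl hφ)⟩
  by_contra hn
  exact (mem_neg (mem_over hφ)).1 (hy φ.neg (Or.inr ⟨φ, rfl, mem_over hφ, hn⟩)) hφ

lemma exists_rel_of_dia {d : Bool} (h : dia d φ ∈ x) : ∃ y, Rel d x y ∧ φ ∈ y := by
  obtain ⟨y, hy, hφ⟩ := exists_rel (x := x) (d := d) (Γ := {φ}) (by
    intro l hl
    have hO := over_dia.1 (mem_over h)
    refine mem_of_imp h (over_dia.2 (over_conj fun ψ hψ => hl ψ hψ ▸ hO)) fun u hu => ?_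
    obtain ⟨w, hw, hw'⟩ := PModel.holds_dia.1 hu
    exact PModel.holds_dia.2 ⟨w, hw, PModel.holds_conj.2 fun ψ hψ => by
      rw [show ψ = φ from hl ψ hψ]; exact hw'⟩)
  exact ⟨y, hy, hφ φ rfl⟩

section Linear

variable (h𝒦 : ∀ F ∈ 𝒦, F.Linear)
include h𝒦

lemma dia_of_dia_dia {d : Bool} (h : dia d (dia d φ) ∈ x) : dia d φ ∈ x := by
  refine mem_of_imp h (over_dia.1 (mem_over h)) fun u hu => ?_
  obtain ⟨w, hw, hw'⟩ := PModel.holds_dia.1 hu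
  obtain ⟨w₂, hw₂, hw₂'⟩ := PModel.holds_dia.1 hw'
  exact PModel.holds_dia.2 ⟨w₂, (h𝒦 u.F u.mem).rel_trans d hw hw₂, hw₂'⟩

lemma Rel.trans {d : Bool} (hxy : Rel d x y) (hyz : Rel d y z) : Rel d x z :=
  fun φ hφ => dia_of_dia_dia h𝒦 (hxy _ (hyz φ hφ))

lemma Rel.conn {d : Bool} (hy : Rel d x y) (hz : Rel d x z) :
    Rel d y z ∨ y = z ∨ Rel d z y := by
  by_contra! hn
  obtain ⟨h1, h2, h3⟩ := hn
  simp only [Rel, not_forall] at h1 h3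
  obtain ⟨α, hα, hαy⟩ := h1
  obtain ⟨β, hβ, hβz⟩ := h3
  obtain ⟨γ, hγ, hγz⟩ : ∃ γ ∈ y, γ ∉ z := by
    by_contra! h
    exact h2 (ext_of_subset h)
  have hy' := hy _ (conj_mem (x := y) (l := [γ, β, (dia d α).neg])
    (by simpa using ⟨hγ, hβ, (mem_neg (over_dia.2 (mem_over hα))).2 hαy⟩))
  have hz' := hz _ (conj_mem (x := z) (l := [α, γ.neg, (dia d β).neg])
    (by simpa using ⟨hα, (mem_neg (mem_over hγ)).2 hγz, (mem_neg (over_dia.2 (mem_over hβ))).2 hβz⟩))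
  obtain ⟨u, hu⟩ := exists_holds (x := x) [_, _] (by simpa using ⟨hy', hz'⟩)
  simp only [List.mem_cons, forall_eq_or_imp, List.not_mem_nil, false_implies, implies_true,
    and_true] at hu
  obtain ⟨⟨a, ha, ha'⟩, ⟨b, hb, hb'⟩⟩ := hu.imp PModel.holds_dia.1 PModel.holds_dia.1
  simp only [PModel.holds_conj, List.mem_cons, forall_eq_or_imp, List.not_mem_nil, false_implies,
    implies_true, and_true] at ha' hb'
  rcases (h𝒦 u.F u.mem).rel_conn d a b with h | h | h
  · exact ha'.2.2 (PModel.holds_dia.2 ⟨b, h, hb'.1⟩)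
  · exact hb'.2.1 (h ▸ ha'.1)
  · exact hb'.2.2 (PModel.holds_dia.2 ⟨a, h, ha'.2.1⟩)

end Linear

/-- the points comparable with `T` -/
def Comp (T : Pt 𝒦 V) : Type := {x : Pt 𝒦 V // x = T ∨ Rel true T x ∨ Rel true x T}

namespace Comp

variable {T : Pt 𝒦 V}

def Rel (d : Bool) (x y : Comp T) : Prop := Pt.Rel d x.1 y.1

lemma rel_not {d : Bool} {x y : Comp T} : Rel (!d) x y ↔ Rel d y x := Pt.rel_not

def root (T : Pt 𝒦 V) : Comp T := ⟨T, Or.inl rfl⟩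

section Linear

variable (h𝒦 : ∀ F ∈ 𝒦, F.Linear)
include h𝒦

lemma trans {d : Bool} {x y z : Comp T} (hxy : Rel d x y) (hyz : Rel d y z) : Rel d x z :=
  Pt.Rel.trans h𝒦 hxy hyz

lemma conn (d : Bool) (x y : Comp T) : Rel d x y ∨ x = y ∨ Rel d y x := by
  have key : Pt.Rel true x.1 y.1 ∨ x.1 = y.1 ∨ Pt.Rel true y.1 x.1 := by
    obtain ⟨x, hx⟩ := x
    obtain ⟨y, hy⟩ := y
    dsimp only
    rcases hx with rfl | hx | hx <;> rcases hy with rfl | hy | hy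
    · exact Or.inr (Or.inl rfl)
    · exact Or.inl hy
    · exact Or.inr (Or.inr hy)
    · exact Or.inr (Or.inr hx)
    · exact Pt.Rel.conn h𝒦 hx hy
    · exact Or.inr (Or.inr (Pt.Rel.trans h𝒦 hy hx))
    · exact Or.inl hx
    · exact Or.inl (Pt.Rel.trans h𝒦 hx hy)
    · have := Pt.Rel.conn (d := false) h𝒦 hx.swap hy.swap
      rcases this with h | h | h
      · exact Or.inr (Or.inr h.swap)
      · exact Or.inr (Or.inl h)
      · exact Or.inl h.swap
  cases d
  · rcases key with h | h | h
    · exact Or.inr (Or.inr h.swap)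
    · exact Or.inr (Or.inl (Subtype.ext h))
    · exact Or.inl h.swap
  · rcases key with h | h | h
    · exact Or.inl h
    · exact Or.inr (Or.inl (Subtype.ext h))
    · exact Or.inr (Or.inr h)

lemma exists_lift {d : Bool} (x : Comp T) {y : Pt 𝒦 V} (h : Pt.Rel d x.1 y) :
    ∃ y' : Comp T, y'.1 = y := by
  refine ⟨⟨y, ?_⟩, rfl⟩
  have h' : Pt.Rel true x.1 y ∨ Pt.Rel true y x.1 := by
    cases d
    · exact Or.inr h.swap
    · exact Or.inl h
  obtain ⟨x, hx⟩ := x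
  dsimp only at h'
  rcases hx with rfl | hx | hx <;> rcases h' with h' | h'
  · exact Or.inr (Or.inl h')
  · exact Or.inr (Or.inr h')
  · exact Or.inr (Or.inl (Pt.Rel.trans h𝒦 hx h'))
  · rcases Pt.Rel.conn (d := false) h𝒦 hx.swap h'.swap with h | h | h
    · exact Or.inr (Or.inr h.swap)
    · exact Or.inl h.symm
    · exact Or.inr (Or.inl h.swap)
  · rcases Pt.Rel.conn h𝒦 hx h' with h | h | h
    · exact Or.inr (Or.inl h)
    · exact Or.inl h.symm
    · exact Or.inr (Or.inr h)
  · exact Or.inr (Or.inr (Pt.Rel.trans h𝒦 h' hx))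

/-- closed nonempty sets of points have a last and a first point -/
lemma exists_last (d : Bool) (Γ : Set TMF) (x₀ : Comp T) (h₀ : ∀ φ ∈ Γ, φ ∈ x₀.1) :
    ∃ y : Comp T, (∀ φ ∈ Γ, φ ∈ y.1) ∧
      ∀ x : Comp T, (∀ φ ∈ Γ, φ ∈ x.1) → x = y ∨ Rel d x y := by
  by_contra! hn
  have next : ∀ y : Comp T, (∀ φ ∈ Γ, φ ∈ y.1) →
      ∃ x : Comp T, (∀ φ ∈ Γ, φ ∈ x.1) ∧ Rel d y x := by
    intro y hy
    obtain ⟨x, hx, hne, hR⟩ := hn y hy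
    rcases conn h𝒦 d x y with h | h | h
    · exact absurd h hR
    · exact absurd h hne
    · exact ⟨x, hx, h⟩
  let Δ : Set TMF := {φ | ∃ ψ, φ = ψ.neg ∧ Over V ψ ∧
    ∃ x : Comp T, (∀ φ ∈ Γ, φ ∈ x.1) ∧ dia d ψ ∉ x.1}
  have fin : ∀ l : List TMF, (∀ φ ∈ l, φ ∈ Γ ∪ Δ) →
      ∃ y : Comp T, (∀ φ ∈ Γ, φ ∈ y.1) ∧
        ∀ φ ∈ l, φ ∈ Γ ∨ ∃ ψ, φ = ψ.neg ∧ Over V ψ ∧ dia d ψ ∉ y.1 := by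
    intro l hl
    induction l with
    | nil => exact ⟨x₀, h₀, by simp⟩
    | cons χ l ih =>
      simp only [List.mem_cons, forall_eq_or_imp] at hl
      obtain ⟨y, hy, hyl⟩ := ih hl.2
      rcases hl.1 with hχ | ⟨ψ, rfl, hψ, x, hx, hxψ⟩
      · exact ⟨y, hy, by simpa using ⟨Or.inl hχ, hyl⟩⟩
      · have mono : ∀ a b : Comp T, Rel d a b → ∀ θ, dia d θ ∉ a.1 → dia d θ ∉ b.1 :=
          fun a b hab θ ha hb => ha (dia_of_dia_dia h𝒦 (hab _ hb))
        rcases conn h𝒦 d x y with h | rfl | h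
        · refine ⟨y, hy, ?_⟩
          simp only [List.mem_cons, forall_eq_or_imp]
          exact ⟨Or.inr ⟨ψ, rfl, hψ, mono _ _ h _ hxψ⟩, hyl⟩
        · refine ⟨x, hx, ?_⟩
          simp only [List.mem_cons, forall_eq_or_imp]
          exact ⟨Or.inr ⟨ψ, rfl, hψ, hxψ⟩, hyl⟩
        · refine ⟨x, hx, ?_⟩
          simp only [List.mem_cons, forall_eq_or_imp]
          refine ⟨Or.inr ⟨ψ, rfl, hψ, hxψ⟩, fun φ hφ => (hyl φ hφ).imp_right ?_⟩
          rintro ⟨θ, rfl, hθ, hθy⟩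
          exact ⟨θ, rfl, hθ, mono _ _ h _ hθy⟩
  obtain ⟨y, hy⟩ := exists_of_finSat (𝒦 := 𝒦) (V := V) (Γ := Γ ∪ Δ) (by
      rintro φ (hφ | ⟨ψ, rfl, hψ, -⟩)
      · exact mem_over (h₀ φ hφ)
      · exact hψ) (by
      intro l hl
      obtain ⟨y, hy, hyl⟩ := fin l hl
      obtain ⟨z, hz, hyz⟩ := next y hy
      refine exists_holds (x := z.1) l fun φ hφ => ?_
      rcases hyl φ hφ with h | ⟨ψ, rfl, hψ, hψy⟩
      · exact hz φ h
      · rw [mem_neg hψ]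
        exact fun h => hψy (hyz ψ h))
  have hR : ∀ x : Comp T, (∀ φ ∈ Γ, φ ∈ x.1) → Pt.Rel d x.1 y := by
    intro x hx φ hφ
    by_contra hc
    exact (mem_neg (mem_over hφ)).1 (hy φ.neg (Or.inr ⟨φ, rfl, mem_over hφ, x, hx, hc⟩)) hφ
  obtain ⟨y', rfl⟩ := exists_lift h𝒦 x₀ (hR x₀ h₀)
  obtain ⟨x, hx, -, hxy⟩ := hn y' fun φ hφ => hy φ (Or.inl hφ)
  exact hxy (hR x hx)

lemma exists_rel_of_dia {d : Bool} {x : Comp T} {φ : TMF} (h : dia d φ ∈ x.1) :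
    ∃ y : Comp T, Rel d x y ∧ φ ∈ y.1 := by
  obtain ⟨y, hy, hφ⟩ := Pt.exists_rel_of_dia h
  obtain ⟨y', rfl⟩ := exists_lift h𝒦 x hy
  exact ⟨y', hy, hφ⟩

lemma exists_refl_last (d : Bool) (hs : ∀ F ∈ 𝒦, ∀ x, ∃ y, F.rel d x y) (T : Pt 𝒦 V) :
    ∃ e : Comp T, ∀ x, Rel d x e := by
  obtain ⟨e, -, he⟩ := exists_last h𝒦 d ∅ (root T) (by simp)
  have hee : Rel d e e := by
    have : dia d .top ∈ e.1 := mem_of_entails [] (by simp) (over_dia.2 over_top) (fun u _ => by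
      obtain ⟨y, hy⟩ := hs u.F u.mem u.x
      exact PModel.holds_dia.2 ⟨y, hy, trivial⟩)
    obtain ⟨y, hy, -⟩ := exists_rel_of_dia h𝒦 this
    rcases he y (by simp) with rfl | h
    · exact hy
    · exact trans h𝒦 hy h
  refine ⟨e, fun x => ?_⟩
  rcases he x (by simp) with rfl | h
  · exact hee
  · exact h

lemma exists_refl_between (hd : ∀ F ∈ 𝒦, ∀ x y, F.R x y → ∃ z, F.R x z ∧ F.R z y)
    {x y : Comp T} (h : Rel true x y) : ∃ z, Rel true z z ∧ Rel true x z ∧ Rel true z y := by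
  let Γ : Set TMF := {φ | ∃ ψ, φ = ψ.neg ∧ Over V ψ ∧ dia true ψ ∉ x.1} ∪
    {φ | ∃ χ ∈ y.1, φ = dia true χ}
  have hΓ : ∀ z : Comp T, (∀ φ ∈ Γ, φ ∈ z.1) ↔ Rel true x z ∧ Rel true z y := by
    intro z
    constructor
    · refine fun hz => ⟨fun φ hφ => ?_, fun φ hφ => hz _ (Or.inr ⟨φ, hφ, rfl⟩)⟩
      by_contra hc
      exact (mem_neg (mem_over hφ)).1 (hz φ.neg (Or.inl ⟨φ, rfl, mem_over hφ, hc⟩)) hφ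
    · rintro ⟨h1, h2⟩ φ (⟨ψ, rfl, hψ, hn⟩ | ⟨χ, hχ, rfl⟩)
      · exact (mem_neg hψ).2 fun hz => hn (h1 ψ hz)
      · exact h2 χ hχ
  have dense : ∀ a b : Comp T, Rel true a b → ∃ c : Comp T, Rel true a c ∧ Rel true c b := by
    intro a b hab
    obtain ⟨c, hc, hcb⟩ := Pt.exists_rel (x := a.1) (d := true)
      (Γ := {φ | ∃ χ ∈ b.1, φ = dia true χ}) (by
        intro l hl
        choose! g hg using hl
        have hm : ∀ φ ∈ l.map g, φ ∈ b.1 := by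
          simp only [List.mem_map, forall_exists_index, and_imp, forall_apply_eq_imp_iff₂]
          exact fun φ hφ => (hg φ hφ).1
        have := hab _ (conj_mem hm)
        refine mem_of_imp this (over_dia.2 (over_conj fun φ hφ => ?_)) fun u hu => ?_
        · rw [(hg φ hφ).2]
          exact over_dia.2 (mem_over (hg φ hφ).1)
        · obtain ⟨w, hw, hw'⟩ := PModel.holds_dia.1 hu
          obtain ⟨w₁, hw₁, hw₂⟩ := hd u.F u.mem _ _ hw
          refine PModel.holds_dia.2 ⟨w₁, hw₁, PModel.holds_conj.2 fun φ hφ => ?_⟩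
          rw [(hg φ hφ).2]
          exact PModel.holds_dia.2
            ⟨w, hw₂, PModel.holds_conj.1 hw' _ (List.mem_map_of_mem hφ)⟩)
    obtain ⟨c', rfl⟩ := exists_lift h𝒦 a hc
    exact ⟨c', hc, fun φ hφ => hcb _ ⟨φ, hφ, rfl⟩⟩
  obtain ⟨c, hxc, hcy⟩ := dense x y h
  obtain ⟨z, hz, hmax⟩ := exists_last h𝒦 true Γ c ((hΓ c).2 ⟨hxc, hcy⟩)
  obtain ⟨hxz, hzy⟩ := (hΓ z).1 hz
  obtain ⟨w, hzw, hwy⟩ := dense z y hzy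
  refine ⟨z, ?_, hxz, hzy⟩
  rcases hmax w ((hΓ w).2 ⟨trans h𝒦 hxz hzw, hwy⟩) with rfl | hwz
  · exact hzw
  · exact trans h𝒦 hzw hwz

lemma exists_irrefl_between
    (hd : ∀ F ∈ 𝒦, ∀ (A : Set F.W) (x y : F.W), F.R x y → (∃ a ∈ A, F.R x a) →
      (¬ ∃ a ∈ A, F.R y a) → ∃ b, F.R x b ∧ (¬ ∃ a ∈ A, F.R b a) ∧
        ∀ c, F.R c b → ∃ a ∈ A, F.R c a)
    {x y : Comp T} (h : Rel true x y) (hyx : ¬ Rel true y x) (hx : Rel true x x)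
    (hy : Rel true y y) : ∃ z, ¬ Rel true z z ∧ Rel true x z ∧ Rel true z y := by
  obtain ⟨α, hα, hαy⟩ : ∃ α ∈ x.1, dia true α ∉ y.1 := by
    simpa only [Rel, Pt.Rel, not_forall, exists_prop] using hyx
  have hO := mem_over hα
  have hO' : Over V (dia true α) := over_dia.2 hO
  have hO2 : Over V (dia false (dia true α).neg).neg := hO'
  let θ : TMF := (dia true α).neg.and (dia false (dia true α).neg).neg
  have hθ : dia true θ ∈ x.1 := by
    refine mem_of_entails [dia true α, dia true (dia true α).neg] ?_
      (over_dia.2 (over_and.2 ⟨hO', hO2⟩)) ?_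
    · simpa using ⟨hx α hα, h _ ((mem_neg hO').2 hαy)⟩
    · intro u hu
      simp only [List.mem_cons, forall_eq_or_imp, List.not_mem_nil, false_implies, implies_true,
        and_true] at hu
      obtain ⟨⟨a, ha, ha'⟩, ⟨w, hw, hw'⟩⟩ := hu.imp PModel.holds_dia.1 PModel.holds_dia.1
      obtain ⟨b, hb, hb', hbc⟩ := hd u.F u.mem {a | (u.move a).Holds α} u.x w hw ⟨a, ha', ha⟩
        (fun ⟨a, ha, hwa⟩ => hw' (PModel.holds_dia.2 ⟨a, hwa, ha⟩))
      refine PModel.holds_dia.2 ⟨b, hb, ?_, ?_⟩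
      · intro hc
        obtain ⟨a, hba, ha⟩ := PModel.holds_dia.1 hc
        exact hb' ⟨a, ha, hba⟩
      · intro hc
        obtain ⟨c, hbc', hc'⟩ := PModel.holds_dia.1 hc
        obtain ⟨a, ha, hca⟩ := hbc c hbc'
        exact hc' (PModel.holds_dia.2 ⟨a, hca, ha⟩)
  obtain ⟨b, hxb, hb⟩ := exists_rel_of_dia h𝒦 hθ
  obtain ⟨hb1, hb2⟩ := (mem_and (over_neg.2 hO') (hO2)).1 hb
  have hpast : ∀ c : Comp T, Rel true c b → dia true α ∈ c.1 := by
    intro c hcb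
    by_contra hc
    exact (mem_neg (φ := dia false (dia true α).neg) hO').1 hb2
      (hcb.swap (dia true α).neg ((mem_neg hO').2 hc))
  have hbb : ¬ Rel true b b := fun hbb => (mem_neg hO').1 hb1 (hpast b hbb)
  refine ⟨b, hbb, hxb, ?_⟩
  rcases conn h𝒦 true b y with h' | rfl | h'
  · exact h'
  · exact absurd hy hbb
  · exact absurd (hpast y h') hαy

end Linear

end Comp

/-- the restriction of a point to a smaller signature -/
def restr (σ : Set ℕ) (x : Pt 𝒦 Set.univ) : Pt 𝒦 σ :=
  ⟨{φ | φ ∈ x ∧ Over σ φ}, by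
    obtain ⟨x, 𝒰, h𝒰⟩ := x
    refine ⟨𝒰, fun φ => ?_⟩
    have : φ ∈ x ↔ _ := h𝒰 φ
    change φ ∈ x ∧ _ ↔ _
    rw [this]
    simp [over_univ, and_comm]⟩

lemma mem_restr {σ : Set ℕ} {x : Pt 𝒦 Set.univ} {φ : TMF} :
    φ ∈ restr σ x ↔ φ ∈ x ∧ Over σ φ := Iff.rfl

lemma Rel.restr {σ : Set ℕ} {d : Bool} {x y : Pt 𝒦 Set.univ} (h : Rel d x y) :
    Rel d (x.restr σ) (y.restr σ) :=
  fun φ (hφ : φ ∈ y ∧ _) => mem_restr.2 ⟨h φ hφ.1, over_dia.2 hφ.2⟩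

lemma restr_eq {σ : Set ℕ} {x : Pt 𝒦 Set.univ} {a : Pt 𝒦 σ} (h : ∀ φ ∈ a, φ ∈ x) :
    restr σ x = a :=
  (ext_of_subset (x := a) (y := restr σ x)
    fun φ hφ => mem_restr.2 ⟨h φ hφ, mem_over hφ⟩).symm

lemma exists_rel_of_restr {σ : Set ℕ} {d : Bool} {x : Pt 𝒦 Set.univ} {a : Pt 𝒦 σ}
    (h : Rel d (restr σ x) a) : ∃ y, Rel d x y ∧ restr σ y = a := by
  obtain ⟨y, hy, ha⟩ := exists_rel (x := x) (d := d) (Γ := {φ | φ ∈ a})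
    (fun l hl => (h _ (conj_mem hl)).1)
  exact ⟨y, hy, restr_eq ha⟩

/-- formulas without an interpolant are realised at points agreeing on the common signature -/
lemma exists_of_noInterpolant {φ₁ φ₂ : TMF} (h : TNoInterpolant (logicOf 𝒦) φ₁ φ₂) :
    ∃ T₁ T₂ : Pt 𝒦 Set.univ, φ₁ ∈ T₁ ∧ φ₂.neg ∈ T₂ ∧
      restr (φ₁.sig ∩ φ₂.sig) T₁ = restr (φ₁.sig ∩ φ₂.sig) T₂ := by
  set σ := φ₁.sig ∩ φ₂.sig with hσ
  let Ξ : Set TMF := {ι | Over σ ι ∧ .imp φ₁ ι ∈ logicOf 𝒦}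
  obtain ⟨T₂, hT₂⟩ := exists_of_finSat (𝒦 := 𝒦) (V := Set.univ) (Γ := insert φ₂.neg Ξ)
    (fun _ _ => over_univ) (by
      classical
      intro l hl
      by_contra! hn
      let l' := l.filter (· ∈ Ξ)
      have hl' : ∀ ι ∈ l', ι ∈ Ξ := by simp [l']
      refine h ⟨conj l', over_conj fun ι hι => (hl' ι hι).1, ?_, ?_⟩
      · rw [mem_logicOf]
        intro u
        rw [PModel.holds_imp, PModel.holds_conj]
        exact fun hu ι hι => PModel.holds_imp.1 (mem_logicOf.1 (hl' ι hι).2 u) hu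
      · rw [mem_logicOf]
        intro u
        rw [PModel.holds_imp, PModel.holds_conj]
        intro hu
        obtain ⟨φ, hφ, hφu⟩ := hn u
        rcases hl φ hφ with rfl | hΞ
        · exact not_not.1 hφu
        · exact absurd (hu φ (by simp [l', hφ, hΞ])) hφu)
  obtain ⟨T₁, hT₁⟩ := exists_of_finSat (𝒦 := 𝒦) (V := Set.univ)
    (Γ := insert φ₁ {ι | ι ∈ restr σ T₂}) (fun _ _ => over_univ) (by
      classical
      intro l hl
      by_contra! hn
      let l' := l.filter (· ∈ restr σ T₂)
      have hl' : ∀ ι ∈ l', ι ∈ restr σ T₂ := by simp [l']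
      have hO : Over σ (conj l') := over_conj fun ι hι => mem_over (hl' ι hι)
      have hΞ : (conj l').neg ∈ Ξ := by
        refine ⟨hO, mem_logicOf.2 fun u => PModel.holds_imp.2 fun hu hc => ?_⟩
        obtain ⟨φ, hφ, hφu⟩ := hn u
        rcases hl φ hφ with rfl | hφ'
        · exact hφu hu
        · exact hφu (PModel.holds_conj.1 hc φ (by
            simp only [l', List.mem_filter, decide_eq_true_eq]; exact ⟨hφ, hφ'⟩))
      exact (mem_neg over_univ).1 (hT₂ _ (Or.inr hΞ)) (conj_mem hl').1)
  exact ⟨T₁, T₂, hT₁ _ (Or.inl rfl), hT₂ _ (Or.inl rfl), restr_eq fun φ hφ => hT₁ φ (Or.inr hφ)⟩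

end Pt

end Canonical

/-! ## Finite selections in linear frames -/

section Selection

def Strict {C : Type} (R : C → C → Prop) (x y : C) : Prop := R x y ∧ ¬ R y x

/-- two adjacent clusters are forbidden if both are degenerate and `bI` holds, or both are
non-degenerate and `bR` holds -/
def Bad (bI bR p q : Prop) : Prop := (bI ∧ ¬ p ∧ ¬ q) ∨ (bR ∧ p ∧ q)

lemma Bad.iff {bI bR p q : Prop} (h : Bad bI bR p q) : p ↔ q := by
  unfold Bad at h; tauto

/-- no two clusters adjacent in `W` are forbidden -/
def Good (bI bR : Prop) {C : Type} (R : C → C → Prop) (W : Set C) : Prop :=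
  ∀ x ∈ W, ∀ y ∈ W, Strict R x y → Bad bI bR (R x x) (R y y) →
    ∃ z ∈ W, Strict R x z ∧ Strict R z y

lemma exists_fill_linearOrder {Q : Type} [LinearOrder Q] (τ : Q → Prop) (bad : Q → Q → Prop)
    (hbad : ∀ c d, bad c d → (τ c ↔ τ d))
    (H : ∀ c d, c < d → bad c d → ∃ e, c < e ∧ e < d ∧ (τ e ↔ ¬ τ c)) (F : Finset Q) :
    ∃ Z : Finset Q, Z.card ≤ F.card ∧
      (∀ z ∈ Z, ∃ c ∈ F, ∃ d ∈ F, c < z ∧ z < d ∧ bad c d ∧ ∀ e ∈ F, ¬ (c < e ∧ e < d)) ∧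
      ∀ c ∈ F ∪ Z, ∀ d ∈ F ∪ Z, c < d → bad c d → ∃ e ∈ F ∪ Z, c < e ∧ e < d := by
  classical
  let gap : Q → Q → Prop := fun c d => d ∈ F ∧ c < d ∧ bad c d ∧ ∀ e ∈ F, ¬ (c < e ∧ e < d)
  have hf : ∀ c, ∃ z, (∃ d, gap c d) → ∃ d, gap c d ∧ c < z ∧ z < d ∧ (τ z ↔ ¬ τ c) := by
    intro c
    by_cases h : ∃ d, gap c d
    · obtain ⟨d, hd⟩ := h
      obtain ⟨z, h1, h2, h3⟩ := H c d hd.2.1 hd.2.2.1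
      exact ⟨z, fun _ => ⟨d, hd, h1, h2, h3⟩⟩
    · exact ⟨c, fun h' => absurd h' h⟩
  choose f hf using hf
  let Z := (F.filter fun c => ∃ d, gap c d).image f
  have hZ : ∀ z ∈ Z, ∃ c ∈ F, z = f c ∧ ∃ d, gap c d ∧ c < z ∧ z < d ∧ (τ z ↔ ¬ τ c) := by
    intro z hz
    obtain ⟨c, hc, rfl⟩ := Finset.mem_image.1 hz
    rw [Finset.mem_filter] at hc
    exact ⟨c, hc.1, rfl, hf c hc.2⟩
  refine ⟨Z, Finset.card_image_le.trans (Finset.card_filter_le _ _), fun z hz => ?_, ?_⟩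
  · obtain ⟨c, hc, -, d, hd, h1, h2, -⟩ := hZ z hz
    exact ⟨c, hc, d, hd.1, h1, h2, hd.2.2⟩
  · intro x hx y hy hxy hb
    by_contra! hadj
    have hadjF : ∀ e ∈ F, ¬ (x < e ∧ e < y) := fun e he h =>
      (hadj e (Finset.mem_union_left _ he) h.1).not_gt h.2
    have hτ := hbad x y hb
    rw [Finset.mem_union] at hx hy
    rcases hx with hx | hx <;> rcases hy with hy | hy
    · have hg : ∃ d, gap x d := ⟨y, hy, hxy, hb, hadjF⟩
      obtain ⟨d, hd, h1, h2, -⟩ := hf x hg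
      have hdy : d ≤ y := not_lt.1 fun h => hd.2.2.2 y hy ⟨hxy, h⟩
      exact (hadj (f x) (Finset.mem_union_right _ (Finset.mem_image_of_mem _
        (Finset.mem_filter.2 ⟨hx, hg⟩))) h1).not_gt (h2.trans_le hdy)
    · obtain ⟨c, hc, -, d, hd, h1, h2, h3⟩ := hZ y hy
      have hcx : c = x := by
        refine le_antisymm (not_lt.1 fun h => hadjF c hc ⟨h, h1⟩) (not_lt.1 fun h => ?_)
        exact hd.2.2.2 x hx ⟨h, hxy.trans h2⟩
      subst hcx
      tauto
    · obtain ⟨c, hc, -, d, hd, h1, h2, h3⟩ := hZ x hx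
      have hdy : d = y := by
        refine le_antisymm (not_lt.1 fun h => ?_) (not_lt.1 fun h => hadjF d hd.1 ⟨h2, h⟩)
        exact hd.2.2.2 y hy ⟨h1.trans hxy, h⟩
      subst hdy
      have := hbad _ _ hd.2.2.1
      tauto
    · obtain ⟨c, hc, hxc, d, hd, h1, h2, -⟩ := hZ x hx
      obtain ⟨c', hc', hyc', d', hd', h1', h2', -⟩ := hZ y hy
      have hc'x : c' ≤ x := not_lt.1 fun h => hadjF c' hc' ⟨h, h1'⟩
      have hcc' : c = c' := by
        refine le_antisymm (not_lt.1 fun h => ?_) (not_lt.1 fun h => ?_)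
        · exact hd'.2.2.2 c hc ⟨h, h1.trans (hxy.trans h2')⟩
        · exact hd.2.2.2 c' hc' ⟨h, hc'x.trans_lt h2⟩
      exact hxy.ne (by rw [hxc, hyc', hcc'])

variable {C : Type} {R : C → C → Prop}

/-- the linear order of clusters -/
lemma exists_clusterMap (htr : ∀ x y z, R x y → R y z → R x z)
    (hcn : ∀ x y, R x y ∨ x = y ∨ R y x) :
    ∃ (Q : Type) (_ : LinearOrder Q) (q : C → Q), Function.Surjective q ∧
      (∀ x y, q x < q y ↔ Strict R x y) ∧ ∀ x y, q x = q y → (R x x ↔ R y y) := by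
  classical
  let _ : Preorder C :=
    { le := fun x y => x = y ∨ R x y
      le_refl := fun x => Or.inl rfl
      le_trans := by
        rintro x y z (rfl | h) (rfl | h')
        · exact Or.inl rfl
        · exact Or.inr h'
        · exact Or.inr h
        · exact Or.inr (htr _ _ _ h h') }
  have : @Std.Total C (· ≤ ·) := ⟨fun x y => by
    change (x = y ∨ R x y) ∨ (y = x ∨ R y x)
    have := hcn x y
    tauto⟩
  refine ⟨Antisymmetrization C (· ≤ ·), inferInstance, toAntisymmetrization (· ≤ ·),
    Quotient.mk_surjective, fun x y => ?_, fun x y h => ?_⟩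
  · rw [toAntisymmetrization_lt_toAntisymmetrization_iff, lt_iff_le_not_ge]
    change (x = y ∨ R x y) ∧ ¬ (y = x ∨ R y x) ↔ _
    constructor
    · rintro ⟨rfl | h, h'⟩
      · exact absurd (Or.inl rfl) h'
      · exact ⟨h, fun h'' => h' (Or.inr h'')⟩
    · rintro ⟨h, h'⟩
      refine ⟨Or.inr h, ?_⟩
      rintro (rfl | h'')
      · exact h' h
      · exact h' h''
  · have h' : x ≤ y ∧ y ≤ x := Quotient.exact h
    obtain ⟨h1 | h1, h2 | h2⟩ : (x = y ∨ R x y) ∧ (y = x ∨ R y x) := h'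
    · rw [h1]
    · rw [h1]
    · rw [h2]
    · exact ⟨fun _ => htr _ _ _ h2 h1, fun _ => htr _ _ _ h1 h2⟩

variable {bI bR : Prop}

/-- every finite set can be made good by adding one point per forbidden gap -/
lemma exists_fill (htr : ∀ x y z, R x y → R y z → R x z)
    (hcn : ∀ x y, R x y ∨ x = y ∨ R y x)
    (H : ∀ x y, Strict R x y → Bad bI bR (R x x) (R y y) →
      ∃ z, Strict R x z ∧ Strict R z y ∧ (R z z ↔ ¬ R x x)) [DecidableEq C] (F : Finset C) :
    ∃ Z : Finset C, Z.card ≤ F.card ∧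
      (∀ z ∈ Z, ∃ x ∈ F, ∃ y ∈ F, Strict R x z ∧ Strict R z y ∧ Bad bI bR (R x x) (R y y) ∧
        ∀ w ∈ F, ¬ (Strict R x w ∧ Strict R w y)) ∧
      Good bI bR R ↑(F ∪ Z) := by
  classical
  obtain ⟨Q, _, q, hsurj, hlt, hq⟩ := exists_clusterMap htr hcn
  let g := Function.surjInv hsurj
  have hg : ∀ c, q (g c) = c := Function.surjInv_eq hsurj
  let τ : Q → Prop := fun c => R (g c) (g c)
  have hτ : ∀ x, τ (q x) ↔ R x x := fun x => hq _ _ (hg _)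
  obtain ⟨Z, hcard, hZ, hgood⟩ := exists_fill_linearOrder τ (fun c d => Bad bI bR (τ c) (τ d))
    (fun c d h => h.iff) (by
      intro c d hcd hb
      have hcd' : Strict R (g c) (g d) := by rw [← hlt, hg, hg]; exact hcd
      obtain ⟨z, h1, h2, h3⟩ := H _ _ hcd' hb
      rw [← hlt, hg] at h1 h2
      exact ⟨q z, h1, h2, by rw [hτ]; exact h3⟩) (F.image q)
  have himage : ∀ c, c ∈ F.image q ∪ Z → ∃ x ∈ F ∪ Z.image g, q x = c := by
    intro c hc
    rcases Finset.mem_union.1 hc with h | h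
    · obtain ⟨x, hx, rfl⟩ := Finset.mem_image.1 h
      exact ⟨x, Finset.mem_union_left _ hx, rfl⟩
    · exact ⟨g c, Finset.mem_union_right _ (Finset.mem_image_of_mem _ h), hg c⟩
  have himage' : ∀ x ∈ F ∪ Z.image g, q x ∈ F.image q ∪ Z := by
    intro x hx
    rcases Finset.mem_union.1 hx with h | h
    · exact Finset.mem_union_left _ (Finset.mem_image_of_mem _ h)
    · obtain ⟨c, hc, rfl⟩ := Finset.mem_image.1 h
      exact Finset.mem_union_right _ (by rwa [hg])
  refine ⟨Z.image g, Finset.card_image_le.trans (hcard.trans Finset.card_image_le), ?_, ?_⟩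
  · intro z hz
    obtain ⟨c, hc, rfl⟩ := Finset.mem_image.1 hz
    obtain ⟨_, hx', _, hy', h1, h2, h3, h4⟩ := hZ c hc
    obtain ⟨x, hx, rfl⟩ := Finset.mem_image.1 hx'
    obtain ⟨y, hy, rfl⟩ := Finset.mem_image.1 hy'
    refine ⟨x, hx, y, hy, ?_, ?_, ?_, fun w hw => ?_⟩
    · rwa [← hlt, hg]
    · rwa [← hlt, hg]
    · simpa only [hτ] using h3
    · rw [← hlt, ← hlt]
      exact h4 _ (Finset.mem_image_of_mem _ hw)
  · intro x hx y hy hxy hb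
    obtain ⟨e, he, h1, h2⟩ := hgood (q x) (himage' x hx) (q y) (himage' y hy) ((hlt _ _).2 hxy)
      (by simpa only [hτ] using hb)
    obtain ⟨z, hz, rfl⟩ := himage e he
    exact ⟨z, hz, (hlt _ _).1 h1, (hlt _ _).1 h2⟩

lemma Strict.congr (htr : ∀ x y z, R x y → R y z → R x z) {x x' y y' : C}
    (hx : x = x' ∨ R x x' ∧ R x' x) (hy : y = y' ∨ R y y' ∧ R y' y) :
    Strict R x y ↔ Strict R x' y' := by
  unfold Strict
  rcases hx with rfl | ⟨hx, hx'⟩ <;> rcases hy with rfl | ⟨hy, hy'⟩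
  · rfl
  · exact ⟨fun h => ⟨htr _ _ _ h.1 hy, fun h' => h.2 (htr _ _ _ hy h')⟩,
      fun h => ⟨htr _ _ _ h.1 hy', fun h' => h.2 (htr _ _ _ hy' h')⟩⟩
  · exact ⟨fun h => ⟨htr _ _ _ hx' h.1, fun h' => h.2 (htr _ _ _ h' hx')⟩,
      fun h => ⟨htr _ _ _ hx h.1, fun h' => h.2 (htr _ _ _ h' hx)⟩⟩
  · exact ⟨fun h => ⟨htr _ _ _ hx' (htr _ _ _ h.1 hy),
        fun h' => h.2 (htr _ _ _ hy (htr _ _ _ h' hx'))⟩,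
      fun h => ⟨htr _ _ _ hx (htr _ _ _ h.1 hy'),
        fun h' => h.2 (htr _ _ _ hy' (htr _ _ _ h' hx))⟩⟩

/-- goodness depends only on the clusters that are met -/
lemma Good.of_subset (htr : ∀ x y z, R x y → R y z → R x z) {W W' : Set C}
    (hW : Good bI bR R W) (hsub : W ⊆ W')
    (h : ∀ x ∈ W', ∃ x' ∈ W, x = x' ∨ R x x' ∧ R x' x) : Good bI bR R W' := by
  have refl_iff : ∀ {x x' : C}, (x = x' ∨ R x x' ∧ R x' x) → (R x x ↔ R x' x') := by
    rintro x x' (rfl | ⟨h1, h2⟩)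
    · rfl
    · exact ⟨fun _ => htr _ _ _ h2 h1, fun _ => htr _ _ _ h1 h2⟩
  intro x hx y hy hxy hb
  obtain ⟨x', hx', hxx'⟩ := h x hx
  obtain ⟨y', hy', hyy'⟩ := h y hy
  rw [refl_iff hxx', refl_iff hyy'] at hb
  obtain ⟨z, hz, h1, h2⟩ := hW x' hx' y' hy' ((Strict.congr htr hxx' hyy').1 hxy) hb
  exact ⟨z, hsub hz, (Strict.congr htr hxx' (Or.inl rfl)).2 h1,
    (Strict.congr htr (Or.inl rfl) hyy').2 h2⟩

/-- a monotone map each of whose fibres has a last and a first point, seen by every point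
whose image sees the fibre -/
structure Cover {S C : Type} (RS : S → S → Prop) (R : C → C → Prop) where
  s : C → S
  top : S → C
  bot : S → C
  mono : ∀ x y, R x y → RS (s x) (s y)
  s_top : ∀ a, s (top a) = a
  s_bot : ∀ a, s (bot a) = a
  rel_top : ∀ x a, RS (s x) a → R x (top a)
  rel_bot : ∀ x a, RS a (s x) → R (bot a) x

variable {S : Type} {RS : S → S → Prop}

/-- a finite set of points together with the extremal points over a finite set of the base -/
def Cover.hull [DecidableEq C] (c : Cover RS R) (B : Finset C) (A : Finset S) : Finset C :=
  B ∪ (A.image c.top ∪ A.image c.bot)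

lemma Cover.card_hull [DecidableEq C] (c : Cover RS R) (B : Finset C) (A : Finset S) :
    (c.hull B A).card ≤ B.card + 2 * A.card := by
  have h1 := Finset.card_union_le B (A.image c.top ∪ A.image c.bot)
  have h2 := Finset.card_union_le (A.image c.top) (A.image c.bot)
  have h3 : (A.image c.top).card ≤ A.card := Finset.card_image_le
  have h4 : (A.image c.bot).card ≤ A.card := Finset.card_image_le
  unfold Cover.hull
  omega

lemma Cover.mem_hull [DecidableEq C] {c : Cover RS R} {B : Finset C} {A : Finset S} {x : C} :
    x ∈ c.hull B A ↔ x ∈ B ∨ (∃ a ∈ A, c.top a = x) ∨ ∃ a ∈ A, c.bot a = x := by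
  simp [Cover.hull]

lemma Cover.exists_fill [DecidableEq C] (c : Cover RS R)
    (htrS : ∀ x y z, RS x y → RS y z → RS x z)
    (htr : ∀ x y z, R x y → R y z → R x z) (hcn : ∀ x y, R x y ∨ x = y ∨ R y x)
    (H : ∀ x y, Strict R x y → Bad bI bR (R x x) (R y y) →
      ∃ z, Strict R x z ∧ Strict R z y ∧ (R z z ↔ ¬ R x x))
    {A : Finset S} (hA : Good bI bR RS ↑A) {B : Finset C} (hB : ∀ x ∈ B, c.s x ∈ A) :
    ∃ Z : Finset C, Z.card ≤ (c.hull B A).card ∧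
      (∀ z ∈ Z, ∃ a ∈ A, RS (c.s z) a ∧ RS a (c.s z)) ∧
      Good bI bR R ↑(c.hull B A ∪ Z) := by
  obtain ⟨Z, hcard, hZ, hgood⟩ := _root_.exists_fill (bI := bI) (bR := bR) htr hcn H (c.hull B A)
  refine ⟨Z, hcard, fun z hz => ?_, hgood⟩
  obtain ⟨x, hx, y, hy, hxz, hzy, hb, hadj⟩ := hZ z hz
  have hs : ∀ w ∈ c.hull B A, c.s w ∈ A := by
    intro w hw
    rcases Cover.mem_hull.1 hw with h | ⟨a, ha, rfl⟩ | ⟨a, ha, rfl⟩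
    · exact hB w h
    · rwa [c.s_top]
    · rwa [c.s_bot]
  have hxy : R x y := htr _ _ _ hxz.1 hzy.1
  suffices hback : RS (c.s y) (c.s x) from
    ⟨c.s x, hs x hx, htrS _ _ _ (c.mono _ _ hzy.1) hback, c.mono _ _ hxz.1⟩
  by_contra hback
  have hSxy : RS (c.s x) (c.s y) := c.mono _ _ hxy
  have left : ∀ w, Strict RS (c.s w) (c.s y) → Strict R w y := by
    intro w hw
    have hyw : ¬ R y w := fun h => hw.2 (c.mono _ _ h)
    rcases hcn w y with h | rfl | h
    · exact ⟨h, hyw⟩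
    · exact absurd hw.1 hw.2
    · exact absurd h hyw
  have right : ∀ w, Strict RS (c.s x) (c.s w) → Strict R x w := by
    intro w hw
    have hwx : ¬ R w x := fun h => hw.2 (c.mono _ _ h)
    rcases hcn x w with h | rfl | h
    · exact ⟨h, hwx⟩
    · exact absurd hw.1 hw.2
    · exact absurd h hwx
  have hxx : R x x ↔ RS (c.s x) (c.s x) := by
    refine ⟨c.mono _ _, fun h => ?_⟩
    have htop : R x (c.top (c.s x)) := c.rel_top _ _ h
    have hty : Strict R (c.top (c.s x)) y := left _ (by rw [c.s_top]; exact ⟨hSxy, hback⟩)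
    by_contra hn
    exact hadj _ (Cover.mem_hull.2 (Or.inr (Or.inl ⟨_, hs x hx, rfl⟩)))
      ⟨⟨htop, fun h' => hn (htr _ _ _ htop h')⟩, hty⟩
  have hyy : R y y ↔ RS (c.s y) (c.s y) := by
    refine ⟨c.mono _ _, fun h => ?_⟩
    have hbot : R (c.bot (c.s y)) y := c.rel_bot _ _ h
    have hxb : Strict R x (c.bot (c.s y)) := right _ (by rw [c.s_bot]; exact ⟨hSxy, hback⟩)
    by_contra hn
    exact hadj _ (Cover.mem_hull.2 (Or.inr (Or.inr ⟨_, hs y hy, rfl⟩)))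
      ⟨hxb, ⟨hbot, fun h' => hn (htr _ _ _ h' hbot)⟩⟩
  rw [hxx, hyy] at hb
  obtain ⟨a, ha, h1, h2⟩ := hA _ (hs x hx) _ (hs y hy) ⟨hSxy, hback⟩ hb
  exact hadj (c.top a) (Cover.mem_hull.2 (Or.inr (Or.inl ⟨a, ha, rfl⟩)))
    ⟨right _ (by rwa [c.s_top]), left _ (by rwa [c.s_top])⟩

lemma Cover.good_hull [DecidableEq C] (c : Cover RS R)
    (htr : ∀ x y z, R x y → R y z → R x z) {A A' : Finset S} {B Z : Finset C}
    (hgood : Good bI bR R ↑(c.hull B A ∪ Z)) (hAA' : A ⊆ A')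
    (hA' : ∀ a ∈ A', a ∈ A ∨ ∃ a' ∈ A, RS a a' ∧ RS a' a) :
    Good bI bR R ↑(c.hull (B ∪ Z) A') := by
  refine hgood.of_subset htr ?_ ?_
  · intro x hx
    simp only [Finset.mem_coe, Finset.mem_union, Cover.mem_hull] at hx ⊢
    rcases hx with (h | ⟨a, ha, h⟩ | ⟨a, ha, h⟩) | h
    · exact Or.inl (Or.inl h)
    · exact Or.inr (Or.inl ⟨a, hAA' ha, h⟩)
    · exact Or.inr (Or.inr ⟨a, hAA' ha, h⟩)
    · exact Or.inl (Or.inr h)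
  · intro x hx
    simp only [Finset.mem_coe, Finset.mem_union, Cover.mem_hull] at hx ⊢
    rcases hx with (h | h) | ⟨a, ha, rfl⟩ | ⟨a, ha, rfl⟩
    · exact ⟨x, Or.inl (Or.inl h), Or.inl rfl⟩
    · exact ⟨x, Or.inr h, Or.inl rfl⟩
    · rcases hA' a ha with h | ⟨a', ha', h1, h2⟩
      · exact ⟨_, Or.inl (Or.inr (Or.inl ⟨a, h, rfl⟩)), Or.inl rfl⟩
      · exact ⟨_, Or.inl (Or.inr (Or.inl ⟨a', ha', rfl⟩)), Or.inr
          ⟨c.rel_top _ _ (by rwa [c.s_top]), c.rel_top _ _ (by rwa [c.s_top])⟩⟩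
    · rcases hA' a ha with h | ⟨a', ha', h1, h2⟩
      · exact ⟨_, Or.inl (Or.inr (Or.inr ⟨a, h, rfl⟩)), Or.inl rfl⟩
      · exact ⟨_, Or.inl (Or.inr (Or.inr ⟨a', ha', rfl⟩)), Or.inr
          ⟨c.rel_bot _ _ (by rwa [c.s_bot]), c.rel_bot _ _ (by rwa [c.s_bot])⟩⟩

/-- two covers of the same base have finite good parts with the same image, closed under taking
extremal points of fibres -/
theorem Cover.exists_selection {C₁ C₂ : Type} {R₁ : C₁ → C₁ → Prop} {R₂ : C₂ → C₂ → Prop}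
    (c₁ : Cover RS R₁) (c₂ : Cover RS R₂)
    (htrS : ∀ x y z, RS x y → RS y z → RS x z) (hcnS : ∀ x y, RS x y ∨ x = y ∨ RS y x)
    (HS : ∀ x y, Strict RS x y → Bad bI bR (RS x x) (RS y y) →
      ∃ z, Strict RS x z ∧ Strict RS z y ∧ (RS z z ↔ ¬ RS x x))
    (htr₁ : ∀ x y z, R₁ x y → R₁ y z → R₁ x z) (hcn₁ : ∀ x y, R₁ x y ∨ x = y ∨ R₁ y x)
    (H₁ : ∀ x y, Strict R₁ x y → Bad bI bR (R₁ x x) (R₁ y y) →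
      ∃ z, Strict R₁ x z ∧ Strict R₁ z y ∧ (R₁ z z ↔ ¬ R₁ x x))
    (htr₂ : ∀ x y z, R₂ x y → R₂ y z → R₂ x z) (hcn₂ : ∀ x y, R₂ x y ∨ x = y ∨ R₂ y x)
    (H₂ : ∀ x y, Strict R₂ x y → Bad bI bR (R₂ x x) (R₂ y y) →
      ∃ z, Strict R₂ x z ∧ Strict R₂ z y ∧ (R₂ z z ↔ ¬ R₂ x x))
    (B₁ : Finset C₁) (B₂ : Finset C₂) :
    ∃ (A : Finset S) (W₁ : Finset C₁) (W₂ : Finset C₂), B₁ ⊆ W₁ ∧ B₂ ⊆ W₂ ∧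
      W₁.card ≤ 34 * (B₁.card + B₂.card) ∧ W₂.card ≤ 34 * (B₁.card + B₂.card) ∧
      Good bI bR R₁ ↑W₁ ∧ Good bI bR R₂ ↑W₂ ∧
      (∀ x ∈ W₁, c₁.s x ∈ A) ∧ (∀ x ∈ W₂, c₂.s x ∈ A) ∧
      (∀ a ∈ A, c₁.top a ∈ W₁ ∧ c₁.bot a ∈ W₁) ∧ ∀ a ∈ A, c₂.top a ∈ W₂ ∧ c₂.bot a ∈ W₂ := by
  classical
  let A₀ := B₁.image c₁.s ∪ B₂.image c₂.s
  obtain ⟨ZS, hZS, -, hA₁⟩ := _root_.exists_fill (bI := bI) (bR := bR) htrS hcnS HS A₀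
  set A₁ := A₀ ∪ ZS with hA₁def
  obtain ⟨Z₁, hZ₁, hsZ₁, hg₁⟩ := c₁.exists_fill htrS htr₁ hcn₁ H₁ hA₁ (B := B₁)
    (fun x hx => Finset.mem_union_left _ (Finset.mem_union_left _ (Finset.mem_image_of_mem _ hx)))
  obtain ⟨Z₂, hZ₂, hsZ₂, hg₂⟩ := c₂.exists_fill htrS htr₂ hcn₂ H₂ hA₁ (B := B₂)
    (fun x hx => Finset.mem_union_left _ (Finset.mem_union_right _ (Finset.mem_image_of_mem _ hx)))
  let A := A₁ ∪ (Z₁.image c₁.s ∪ Z₂.image c₂.s)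
  have hA : ∀ a ∈ A, a ∈ A₁ ∨ ∃ a' ∈ A₁, RS a a' ∧ RS a' a := by
    intro a ha
    rcases Finset.mem_union.1 ha with h | h
    · exact Or.inl h
    · rcases Finset.mem_union.1 h with h | h
      · obtain ⟨z, hz, rfl⟩ := Finset.mem_image.1 h
        exact Or.inr (hsZ₁ z hz)
      · obtain ⟨z, hz, rfl⟩ := Finset.mem_image.1 h
        exact Or.inr (hsZ₂ z hz)
  have hAA : A₁ ⊆ A := Finset.subset_union_left
  have e1 : A₀.card ≤ (B₁.image c₁.s).card + (B₂.image c₂.s).card := Finset.card_union_le _ _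
  have e2 : (B₁.image c₁.s).card ≤ B₁.card := Finset.card_image_le
  have e3 : (B₂.image c₂.s).card ≤ B₂.card := Finset.card_image_le
  have e4 : A₁.card ≤ A₀.card + ZS.card := Finset.card_union_le _ _
  have e5 := c₁.card_hull B₁ A₁
  have e6 := c₂.card_hull B₂ A₁
  have e7 : A.card ≤ A₁.card + (Z₁.image c₁.s ∪ Z₂.image c₂.s).card := Finset.card_union_le _ _
  have e8 := Finset.card_union_le (Z₁.image c₁.s) (Z₂.image c₂.s)
  have e9 : (Z₁.image c₁.s).card ≤ Z₁.card := Finset.card_image_le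
  have e10 : (Z₂.image c₂.s).card ≤ Z₂.card := Finset.card_image_le
  have e11 := c₁.card_hull (B₁ ∪ Z₁) A
  have e12 := c₂.card_hull (B₂ ∪ Z₂) A
  have e13 := Finset.card_union_le B₁ Z₁
  have e14 := Finset.card_union_le B₂ Z₂
  refine ⟨A, c₁.hull (B₁ ∪ Z₁) A, c₂.hull (B₂ ∪ Z₂) A, ?_, ?_, by omega, by omega,
    c₁.good_hull htr₁ hg₁ hAA hA, c₂.good_hull htr₂ hg₂ hAA hA, ?_, ?_, ?_, ?_⟩
  · exact fun x hx => Cover.mem_hull.2 (Or.inl (Finset.mem_union_left _ hx))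
  · exact fun x hx => Cover.mem_hull.2 (Or.inl (Finset.mem_union_left _ hx))
  · intro x hx
    rcases Cover.mem_hull.1 hx with h | ⟨a, ha, rfl⟩ | ⟨a, ha, rfl⟩
    · rcases Finset.mem_union.1 h with h | h
      · simp only [A, A₁, A₀, Finset.mem_union]
        exact Or.inl (Or.inl (Or.inl (Finset.mem_image_of_mem _ h)))
      · simp only [A, Finset.mem_union]
        exact Or.inr (Or.inl (Finset.mem_image_of_mem _ h))
    · rwa [c₁.s_top]
    · rwa [c₁.s_bot]
  · intro x hx
    rcases Cover.mem_hull.1 hx with h | ⟨a, ha, rfl⟩ | ⟨a, ha, rfl⟩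
    · rcases Finset.mem_union.1 h with h | h
      · simp only [A, A₁, A₀, Finset.mem_union]
        exact Or.inl (Or.inl (Or.inr (Finset.mem_image_of_mem _ h)))
      · simp only [A, Finset.mem_union]
        exact Or.inr (Or.inr (Finset.mem_image_of_mem _ h))
    · rwa [c₂.s_top]
    · rwa [c₂.s_bot]
  · exact fun a ha => ⟨Cover.mem_hull.2 (Or.inr (Or.inl ⟨a, ha, rfl⟩)),
      Cover.mem_hull.2 (Or.inr (Or.inr ⟨a, ha, rfl⟩))⟩
  · exact fun a ha => ⟨Cover.mem_hull.2 (Or.inr (Or.inl ⟨a, ha, rfl⟩)),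
      Cover.mem_hull.2 (Or.inr (Or.inr ⟨a, ha, rfl⟩))⟩

end Selection

/-! ## Finite frames as images of dense linear orders -/

section Dense

lemma sat_of_pMorphism {X W : Type} {S : X → X → Prop} {R : W → W → Prop} {f : X → W}
    (mono : ∀ t s, S t s → R (f t) (f s)) (forth : ∀ t w, R (f t) w → ∃ s, S t s ∧ f s = w)
    (back : ∀ t w, R w (f t) → ∃ s, S s t ∧ f s = w) (v : ℕ → Set W) (φ : TMF) (t : X) :
    (TModel.mk (tKripke X S) fun p => f ⁻¹' v p).sat t φ ↔
      (TModel.mk (tKripke W R) v).sat (f t) φ := by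
  induction φ generalizing t with
  | var p => rfl
  | top => rfl
  | bot => rfl
  | neg φ ih => exact not_congr (ih t)
  | and φ ψ ih ih' => exact and_congr (ih t) (ih' t)
  | diaF φ ih =>
    constructor
    · rintro ⟨s, hts, hs⟩
      exact ⟨f s, mono t s hts, (ih s).1 hs⟩
    · rintro ⟨w, htw, hw⟩
      obtain ⟨s, hts, rfl⟩ := forth t w htw
      exact ⟨s, hts, (ih s).2 hw⟩
  | diaP φ ih =>
    constructor
    · rintro ⟨s, hts, hs⟩
      exact ⟨f s, mono s t hts, (ih s).1 hs⟩
    · rintro ⟨w, htw, hw⟩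
      obtain ⟨s, hts, rfl⟩ := back t w htw
      exact ⟨s, hts, (ih s).2 hw⟩

lemma valid_of_pMorphism {X W : Type} {S : X → X → Prop} {R : W → W → Prop} {f : X → W}
    (mono : ∀ t s, S t s → R (f t) (f s)) (forth : ∀ t w, R (f t) w → ∃ s, S t s ∧ f s = w)
    (back : ∀ t w, R w (f t) → ∃ s, S s t ∧ f s = w) (hf : Function.Surjective f) {φ : TMF}
    (h : (tKripke X S).Valid φ) : (tKripke W R).Valid φ := by
  intro v _ w
  obtain ⟨t, rfl⟩ := hf w
  exact (sat_of_pMorphism mono forth back v φ t).1 (h _ (fun _ => trivial) t)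

variable {X : Type} [LinearOrder X]

/-- a cut of `X` above `m` without boundary points -/
def HasGap (X : Type) [LinearOrder X] : Prop :=
  ∀ m : X, ∃ A : Set X, IsLowerSet A ∧ m ∈ A ∧ (∃ t, t ∉ A) ∧ (∀ t ∈ A, ∃ s ∈ A, t < s) ∧
    ∀ t ∉ A, ∃ s ∉ A, s < t

/-- a monotone map onto `{0, …, n}` which is locally constant over `τ` and injective elsewhere -/
structure IsStaircase (τ : ℕ → Prop) (n : ℕ) (g : X → ℕ) : Prop where
  mono : ∀ t s, t ≤ s → g t ≤ g s
  le : ∀ t, g t ≤ n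
  surj : ∀ j ≤ n, ∃ t, g t = j
  locConst : ∀ t, τ (g t) → ∃ a b, a < t ∧ t < b ∧ ∀ s, a < s → s < b → g s = g t
  inj : ∀ t, ¬ τ (g t) → ∀ s, g s = g t → s = t

lemma exists_isStaircase [NoMinOrder X] [NoMaxOrder X] [Nonempty X]
    {τ : ℕ → Prop} (h0 : τ 0) (n : ℕ) (hn : τ n)
    (hirr : ∀ j < n, τ j ∨ τ (j + 1)) (hgap : (∃ j < n, τ j ∧ τ (j + 1)) → HasGap X) :
    ∃ g : X → ℕ, IsStaircase τ n g ∧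
      ∃ m, (∀ t, m ≤ t → g t = n) ∧ ∀ j ≤ n, ∃ t ≤ m, g t = j := by
  induction n using Nat.strong_induction_on with
  | _ n ih =>
  rcases n with _ | n
  · obtain ⟨m⟩ := ‹Nonempty X›
    refine ⟨fun _ => 0, ⟨fun _ _ _ => le_rfl, fun _ => le_rfl, fun j hj => ⟨m, (Nat.le_zero.1 hj).symm⟩,
      fun t _ => ?_, fun t ht => absurd h0 ht⟩, m, fun _ _ => rfl, 
      fun j hj => ⟨m, le_rfl, (Nat.le_zero.1 hj).symm⟩⟩
    obtain ⟨a, ha⟩ := exists_lt t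
    obtain ⟨b, hb⟩ := exists_gt t
    exact ⟨a, b, ha, hb, fun _ _ _ => rfl⟩
  by_cases hτ : τ n
  · obtain ⟨g, hg, m, hm, hs⟩ := ih n (by omega) hτ (fun j hj => hirr j (by omega))
      fun ⟨j, hj, h⟩ => hgap ⟨j, by omega, h⟩
    obtain ⟨A, hA, hmA, ⟨y, hy⟩, hup, hdown⟩ := hgap ⟨n, by omega, hτ, hn⟩ m
    classical
    have hin : ∀ t ∈ A, (if t ∈ A then g t else n + 1) = g t := fun t ht => if_pos ht
    have hout : ∀ t ∉ A, (if t ∈ A then g t else n + 1) = n + 1 := fun t ht => if_neg ht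
    refine ⟨fun t => if t ∈ A then g t else n + 1, ⟨?_, ?_, ?_, ?_, ?_⟩, y, ?_, ?_⟩
    · intro t s hts
      by_cases hsA : s ∈ A
      · simpa only [hin _ hsA, hin _ (hA hts hsA)] using hg.mono t s hts
      · by_cases htA : t ∈ A
        · simpa only [hin _ htA, hout _ hsA] using (hg.le t).trans (Nat.le_succ n)
        · simp only [hout _ htA, hout _ hsA, le_refl]
    · intro t
      by_cases htA : t ∈ A
      · simpa only [hin _ htA] using (hg.le t).trans (Nat.le_succ n)
      · simp only [hout _ htA, le_refl]
    · intro j hj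
      rcases Nat.lt_or_ge n j with h | h
      · exact ⟨y, by simp only [hout _ hy]; omega⟩
      · obtain ⟨t, htm, ht⟩ := hs j h
        exact ⟨t, by simpa only [hin _ (hA htm hmA)] using ht⟩
    · intro t ht
      by_cases htA : t ∈ A
      · simp only [hin _ htA] at ht ⊢
        obtain ⟨a, b, ha, hb, hc⟩ := hg.locConst t ht
        obtain ⟨s, hs, hts⟩ := hup t htA
        refine ⟨a, min b s, ha, lt_min hb hts, fun r har hrb => ?_⟩
        rw [hin r (hA (hrb.le.trans (min_le_right _ _)) hs)]
        exact hc r har (hrb.trans_le (min_le_left _ _))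
      · obtain ⟨s, hs, hst⟩ := hdown t htA
        obtain ⟨b, hb⟩ := exists_gt t
        refine ⟨s, b, hst, hb, fun r hr _ => ?_⟩
        simp only [hout _ htA, hout r fun h => hs (hA hr.le h)]
    · intro t ht s hst
      by_cases htA : t ∈ A
      · by_cases hsA : s ∈ A
        · simp only [hin _ htA, hin _ hsA] at ht hst
          exact hg.inj t ht s hst
        · simp only [hin _ htA, hout _ hsA] at hst
          have := hg.le t
          omega
      · simp only [hout _ htA] at ht
        exact absurd hn ht
    · intro t ht
      exact hout t fun h => hy (hA ht h)
    · intro j hj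
      rcases Nat.lt_or_ge n j with h | h
      · exact ⟨y, le_rfl, by simp only [hout _ hy]; omega⟩
      · obtain ⟨t, htm, ht⟩ := hs j h
        refine ⟨t, le_of_not_ge fun h => hy (hA (h.trans htm) hmA), ?_⟩
        simpa only [hin _ (hA htm hmA)] using ht
  · rcases n with _ | k
    · exact absurd h0 hτ
    have hk : τ k := (hirr k (by omega)).resolve_right hτ
    obtain ⟨g, hg, m, hm, hs⟩ := ih k (by omega) hk (fun j hj => hirr j (by omega))
      fun ⟨j, hj, h⟩ => hgap ⟨j, by omega, h⟩
    obtain ⟨M, hM⟩ := exists_gt m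
    obtain ⟨y, hy⟩ := exists_gt M
    set g' : X → ℕ := fun t => if t < M then g t else if t = M then k + 1 else k + 1 + 1 with hg'
    have hlt : ∀ t, t < M → g' t = g t := fun t ht => if_pos ht
    have hMM : g' M = k + 1 := by simp [hg']
    have hgt : ∀ t, M < t → g' t = k + 1 + 1 := fun t ht => by
      simp [hg', ht.not_gt, ht.ne']
    refine ⟨g', ⟨?_, ?_, ?_, ?_, ?_⟩, y, ?_, ?_⟩
    · intro t s hts
      have := hg.le t
      rcases lt_trichotomy s M with h | rfl | h
      · rw [hlt s h, hlt t (hts.trans_lt h)]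
        exact hg.mono t s hts
      · rcases hts.lt_or_eq with h | rfl
        · rw [hlt t h, hMM]; omega
        · rfl
      · rcases lt_trichotomy t M with h' | rfl | h'
        · rw [hlt t h', hgt s h]; omega
        · rw [hMM, hgt s h]; omega
        · rw [hgt t h', hgt s h]
    · intro t
      have := hg.le t
      rcases lt_trichotomy t M with h | rfl | h
      · rw [hlt t h]; omega
      · rw [hMM]; omega
      · rw [hgt t h]
    · intro j hj
      rcases Nat.lt_or_ge k j with h | h
      · rcases Nat.lt_or_ge (k + 1) j with h' | h'
        · exact ⟨y, by rw [hgt y hy]; omega⟩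
        · exact ⟨M, by rw [hMM]; omega⟩
      · obtain ⟨t, htm, ht⟩ := hs j h
        exact ⟨t, by rwa [hlt t (htm.trans_lt hM)]⟩
    · intro t ht
      rcases lt_trichotomy t M with h | rfl | h
      · rw [hlt t h] at ht ⊢
        obtain ⟨a, b, ha, hb, hc⟩ := hg.locConst t ht
        refine ⟨a, min b M, ha, lt_min hb h, fun r har hrb => ?_⟩
        rw [hlt r (hrb.trans_le (min_le_right _ _))]
        exact hc r har (hrb.trans_le (min_le_left _ _))
      · rw [hMM] at ht
        exact absurd ht hτ
      · obtain ⟨b, hb⟩ := exists_gt t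
        exact ⟨M, b, h, hb, fun r hr _ => by rw [hgt r hr, hgt t h]⟩
    · intro t ht s hst
      have h1 := hg.le t
      have h2 := hg.le s
      rcases lt_trichotomy t M with h | h | h <;> rcases lt_trichotomy s M with h' | h' | h'
      · rw [hlt t h] at ht
        rw [hlt t h, hlt s h'] at hst
        exact hg.inj t ht s hst
      · rw [h', hMM, hlt t h] at hst; omega
      · rw [hgt s h', hlt t h] at hst; omega
      · rw [h, hMM, hlt s h'] at hst; omega
      · rw [h, h']
      · rw [h, hMM, hgt s h'] at hst; omega
      all_goals
        rw [hgt t h] at ht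
        exact absurd hn ht
    · exact fun t ht => hgt t (hy.trans_le ht)
    · intro j hj
      rcases Nat.lt_or_ge k j with h | h
      · rcases Nat.lt_or_ge (k + 1) j with h' | h'
        · exact ⟨y, le_rfl, by rw [hgt y hy]; omega⟩
        · exact ⟨M, hy.le, by rw [hMM]; omega⟩
      · obtain ⟨t, htm, ht⟩ := hs j h
        exact ⟨t, (htm.trans_lt (hM.trans hy)).le, by rwa [hlt t (htm.trans_lt hM)]⟩

/-- a partition of `X` into countably many dense sets -/
def HasColouring (X : Type) [LinearOrder X] : Prop :=
  ∃ col : X → ℕ, ∀ i a b, a < b → ∃ t, a < t ∧ t < b ∧ col t = i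

variable {W : Type} {R : W → W → Prop}

lemma valid_of_clusterMap (hcol : HasColouring X) [Countable W]
    (htr : ∀ x y z, R x y → R y z → R x z) {c : X → W}
    (mono : ∀ t s, t ≤ s → c t = c s ∨ R (c t) (c s))
    (surj : ∀ w, ∃ t, c t = w ∨ R (c t) w ∧ R w (c t))
    (loc : ∀ t, R (c t) (c t) → ∃ a b, a < t ∧ t < b ∧ ∀ s, a < s → s < b → c s = c t)
    (inj : ∀ t, ¬ R (c t) (c t) → ∀ s, c s = c t → s = t) {φ : TMF}
    (h : (tKripke X (· < ·)).Valid φ) : (tKripke W R).Valid φ := by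
  obtain ⟨col, hcol⟩ := hcol
  have he : ∀ w, ∃ e : ℕ → W, Set.range e = {u | u = w ∨ R w u ∧ R u w} := fun w => by
    obtain ⟨e, he⟩ := (Set.to_countable {u | u = w ∨ R w u ∧ R u w}).exists_eq_range
      ⟨w, Or.inl rfl⟩
    exact ⟨e, he.symm⟩
  choose e he using he
  let f : X → W := fun t => e (c t) (col t)
  have hf : ∀ t, f t = c t ∨ R (c t) (f t) ∧ R (f t) (c t) := fun t => by
    have : f t ∈ Set.range (e (c t)) := ⟨_, rfl⟩
    rwa [he] at this
  have hf' : ∀ t, ¬ R (c t) (c t) → f t = c t := fun t ht =>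
    (hf t).resolve_right fun h => ht (htr _ _ _ h.1 h.2)
  have dense : ∀ t w, R (c t) w → R w (c t) → (∃ s, t < s ∧ f s = w) ∧ ∃ s, s < t ∧ f s = w := by
    intro t w h1 h2
    have : w ∈ Set.range (e (c t)) := by rw [he]; exact Or.inr ⟨h1, h2⟩
    obtain ⟨i, hi⟩ := this
    obtain ⟨a, b, ha, hb, hc⟩ := loc t (htr _ _ _ h1 h2)
    obtain ⟨s, h1, h2, h3⟩ := hcol i t b hb
    obtain ⟨s', h1', h2', h3'⟩ := hcol i a t ha
    exact ⟨⟨s, h1, by simp only [f, hc s (ha.trans h1) h2, h3, hi]⟩,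
      ⟨s', h2', by simp only [f, hc s' h1' (h2'.trans hb), h3', hi]⟩⟩
  have left : ∀ t w, R (f t) w ↔ R (c t) w := fun t w => by
    rcases hf t with h | h
    · rw [h]
    · exact ⟨htr _ _ _ h.1, htr _ _ _ h.2⟩
  have right : ∀ t w, R w (f t) ↔ R w (c t) := fun t w => by
    rcases hf t with h | h
    · rw [h]
    · exact ⟨fun h' => htr _ _ _ h' h.2, fun h' => htr _ _ _ h' h.1⟩
  have cover : ∀ w, ∃ t, (f t = w ∧ c t = w) ∨ R (c t) w ∧ R w (c t) := by
    intro w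
    obtain ⟨t, ht | ht⟩ := surj w
    · by_cases hr : R w w
      · exact ⟨t, Or.inr (by rw [ht]; exact ⟨hr, hr⟩)⟩
      · exact ⟨t, Or.inl ⟨by rw [hf' t (by rwa [ht]), ht], ht⟩⟩
    · exact ⟨t, Or.inr ht⟩
  refine valid_of_pMorphism (f := f) ?_ ?_ ?_ ?_ h
  · intro t s hts
    rw [left, right]
    rcases mono t s hts.le with h | h
    · by_contra hn
      rw [h] at hn
      exact hts.ne (inj s hn t h)
    · exact h
  · intro t w hw
    rw [left] at hw
    obtain ⟨s, hs⟩ := cover w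
    rcases lt_or_ge t s with h | h
    · rcases hs with hs | hs
      · exact ⟨s, h, hs.1⟩
      · obtain ⟨⟨r, hr, hrw⟩, -⟩ := dense s w hs.1 hs.2
        exact ⟨r, h.trans hr, hrw⟩
    · have hwt : R w (c t) := by
        rcases mono s t h with h | h <;> rcases hs with hs | hs
        · rw [← h, hs.2]; rwa [← h, hs.2] at hw
        · rw [← h]; exact hs.2
        · rwa [hs.2] at h
        · exact htr _ _ _ hs.2 h
      exact (dense t w hw hwt).1
  · intro t w hw
    rw [right] at hw
    obtain ⟨s, hs⟩ := cover w
    rcases lt_or_ge s t with h | h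
    · rcases hs with hs | hs
      · exact ⟨s, h, hs.1⟩
      · obtain ⟨-, r, hr, hrw⟩ := dense s w hs.1 hs.2
        exact ⟨r, hr.trans h, hrw⟩
    · have hwt : R (c t) w := by
        rcases mono t s h with h | h <;> rcases hs with hs | hs
        · rw [h, hs.2]; rwa [h, hs.2] at hw
        · rw [h]; exact hs.1
        · rwa [hs.2] at h
        · exact htr _ _ _ h hs.1
      exact (dense t w hwt hw).2
  · intro w
    obtain ⟨t, ht | ht⟩ := cover w
    · exact ⟨t, ht.1⟩
    · obtain ⟨⟨s, -, hs⟩, -⟩ := dense t w ht.1 ht.2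
      exact ⟨s, hs⟩

/-- a finite serial linear frame without forbidden gaps validates the logic of `X` -/
theorem valid_of_good [NoMinOrder X] [NoMaxOrder X] [Nonempty X] (hcol : HasColouring X)
    {bR : Prop} (hgap : bR ∨ HasGap X) [Finite W]
    (htr : ∀ x y z, R x y → R y z → R x z) (hcn : ∀ x y, R x y ∨ x = y ∨ R y x)
    (hlast : ∃ w, ∀ x, R x w) (hfirst : ∃ w, ∀ x, R w x) (hgood : Good True bR R Set.univ)
    {φ : TMF} (h : (tKripke X (· < ·)).Valid φ) : (tKripke W R).Valid φ := by
  classical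
  obtain ⟨Q, _, q, hsurj, hlt, hq⟩ := exists_clusterMap htr hcn
  have : Finite Q := Finite.of_surjective q hsurj
  have : Fintype Q := Fintype.ofFinite Q
  obtain ⟨l, hl⟩ := hlast
  obtain ⟨i, hi⟩ := hfirst
  have hcard : 0 < Fintype.card Q := Fintype.card_pos_iff.2 ⟨q l⟩
  obtain ⟨n, hn⟩ : ∃ n, Fintype.card Q = n + 1 := ⟨_, (Nat.succ_pred_eq_of_pos hcard).symm⟩
  let o : Fin (n + 1) ≃o Q := Fintype.orderIsoFinOfCardEq Q hn
  let p : Fin (n + 1) → W := fun j => Function.surjInv hsurj (o j)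
  have hp : ∀ j, q (p j) = o j := fun j => Function.surjInv_eq hsurj _
  have hpStrict : ∀ j k, Strict R (p j) (p k) ↔ j < k := fun j k => by
    rw [← hlt, hp, hp, o.lt_iff_lt]
  let pn : ℕ → W := fun j => p (Fin.ofNat (n + 1) j)
  have hpn : ∀ j k, j ≤ n → k ≤ n → (Strict R (pn j) (pn k) ↔ j < k) := by
    intro j k hj hk
    rw [hpStrict, Fin.lt_def, Fin.val_ofNat, Fin.val_ofNat, Nat.mod_eq_of_lt (by omega),
      Nat.mod_eq_of_lt (by omega)]
  have hadj : ∀ j < n, ¬ ∃ z, Strict R (pn j) z ∧ Strict R z (pn (j + 1)) := by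
    rintro j hj ⟨z, h1, h2⟩
    obtain ⟨k, hk⟩ := o.surjective (q z)
    rw [← hlt, ← hk, hp, o.lt_iff_lt, Fin.lt_def] at h1 h2
    rw [Fin.val_ofNat, Nat.mod_eq_of_lt (by omega)] at h1 h2
    omega
  have hpne : ∀ w, ∃ j ≤ n, pn j = w ∨ R (pn j) w ∧ R w (pn j) := by
    intro w
    obtain ⟨k, hk⟩ := o.surjective (q w)
    refine ⟨k, by omega, ?_⟩
    have hkk : pn k = p k := by
      simp only [pn]
      congr 1
      ext
      rw [Fin.val_ofNat, Nat.mod_eq_of_lt k.2]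
    rw [hkk]
    have hqq : q (p k) = q w := by rw [hp, hk]
    have n1 : ¬ Strict R (p k) w := by rw [← hlt, hqq]; exact lt_irrefl _
    have n2 : ¬ Strict R w (p k) := by rw [← hlt, hqq]; exact lt_irrefl _
    unfold Strict at n1 n2
    have := hcn (p k) w
    tauto
  let τ : ℕ → Prop := fun j => R (pn j) (pn j)
  have h0 : τ 0 := by
    obtain ⟨j, hj, h | h⟩ := hpne i
    · have : j = 0 := by
        by_contra h0
        have := (hpn 0 j (by omega) hj).2 (by omega)
        rw [h] at this
        exact this.2 (hi _)
      subst this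
      change R (pn 0) (pn 0)
      rw [h]; exact hi i
    · by_contra hn
      have h0j : Strict R (pn 0) (pn j) := (hpn 0 j (by omega) hj).2 (by
        rcases Nat.eq_zero_or_pos j with rfl | h'
        · exact absurd (htr _ _ _ h.1 h.2) hn
        · exact h')
      exact h0j.2 (htr _ _ _ h.1 (hi _))
  have hτn : τ n := by
    obtain ⟨j, hj, h | h⟩ := hpne l
    · have : j = n := by
        by_contra h0
        have := (hpn j n hj le_rfl).2 (by omega)
        rw [h] at this
        exact this.2 (hl _)
      subst this
      change R (pn j) (pn j)
      rw [h]; exact hl l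
    · by_contra hn
      have hjn : Strict R (pn j) (pn n) := (hpn j n hj le_rfl).2 (by
        rcases hj.lt_or_eq with h' | rfl
        · exact h'
        · exact absurd (htr _ _ _ h.1 h.2) hn)
      exact hjn.2 (htr _ _ _ (hl _) h.2)
  have hbad : ∀ j < n, ¬ Bad True bR (τ j) (τ (j + 1)) := fun j hj hb => by
    obtain ⟨z, -, hz⟩ := hgood _ trivial _ trivial
      ((hpn j (j + 1) hj.le hj).2 (Nat.lt_succ_self j)) hb
    exact hadj j hj ⟨z, hz⟩
  obtain ⟨g, hg, -⟩ := exists_isStaircase (X := X) h0 n hτn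
    (fun j hj => by have := hbad j hj; unfold Bad at this; tauto)
    (fun ⟨j, hj, h⟩ => hgap.resolve_left fun hR => hbad j hj (Or.inr ⟨hR, h⟩))
  have hpinj : ∀ t s, pn (g s) = pn (g t) → g s = g t := by
    intro t s h
    by_contra hne
    rcases Nat.lt_or_gt_of_ne hne with h' | h'
    · have := (hpn _ _ (hg.le s) (hg.le t)).2 h'
      rw [h] at this
      exact this.2 this.1
    · have := (hpn _ _ (hg.le t) (hg.le s)).2 h'
      rw [h] at this
      exact this.2 this.1
  refine valid_of_clusterMap hcol htr (c := fun t => pn (g t)) ?_ ?_ ?_ ?_ h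
  · intro t s hts
    rcases (hg.mono t s hts).lt_or_eq with h | h
    · exact Or.inr ((hpn _ _ (hg.le t) (hg.le s)).2 h).1
    · exact Or.inl (congrArg pn h)
  · intro w
    obtain ⟨j, hj, h⟩ := hpne w
    obtain ⟨t, rfl⟩ := hg.surj j hj
    exact ⟨t, h⟩
  · intro t ht
    obtain ⟨a, b, ha, hb, hc⟩ := hg.locConst t ht
    exact ⟨a, b, ha, hb, fun s h1 h2 => congrArg pn (hc s h1 h2)⟩
  · exact fun t ht s hst => hg.inj t ht s (hpinj t s hst)

lemma hasGap_rat : HasGap ℚ := by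
  intro m
  obtain ⟨x, hx, hmx, -⟩ := exists_irrational_btwn (show (m : ℝ) < m + 1 by linarith)
  refine ⟨{q | (q : ℝ) < x}, fun a b hba ha => ?_, hmx, ?_, fun t ht => ?_, fun t ht => ?_⟩
  · have : (b : ℝ) ≤ a := by exact_mod_cast hba
    exact this.trans_lt ha
  · obtain ⟨q, hq⟩ := exists_rat_gt x
    exact ⟨q, not_lt.2 hq.le⟩
  · obtain ⟨q, h1, h2⟩ := exists_rat_btwn (show (t : ℝ) < x from ht)
    exact ⟨q, h2, by exact_mod_cast h1⟩
  · have hxt : x < t := lt_of_le_of_ne (not_lt.1 ht) (hx.ne_rat t)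
    obtain ⟨q, h1, h2⟩ := exists_rat_btwn hxt
    exact ⟨q, not_lt.2 h1.le, by exact_mod_cast h2⟩

lemma hasColouring_rat : HasColouring ℚ := by
  refine ⟨fun q => (Nat.unpair (Nat.log 2 q.den)).1, fun i a b hab => ?_⟩
  obtain ⟨j, hj⟩ := exists_nat_gt (2 / (b - a))
  set k := Nat.pair i j with hk
  have hjk : j ≤ k := Nat.right_le_pair i j
  have hpow : (2 : ℚ) / (b - a) < 2 ^ k := by
    have h1 : (j : ℚ) < 2 ^ k := by exact_mod_cast hjk.trans_lt Nat.lt_two_pow_self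
    exact hj.trans h1
  have hba : 0 < b - a := sub_pos.2 hab
  have h2k : (0 : ℚ) < 2 ^ k := by positivity
  rw [div_lt_iff₀ hba] at hpow
  let m : ℤ := 2 * ⌊(a * 2 ^ k + 1) / 2⌋ + 1
  have hm1 : a * 2 ^ k < m := by
    have := Int.lt_floor_add_one ((a * 2 ^ k + 1) / 2)
    simp only [m]; push_cast; linarith
  have hm2 : (m : ℚ) ≤ a * 2 ^ k + 2 := by
    have := Int.floor_le ((a * 2 ^ k + 1) / 2)
    simp only [m]; push_cast; linarith
  refine ⟨m / 2 ^ k, by rwa [lt_div_iff₀ h2k], by rw [div_lt_iff₀ h2k]; linarith, ?_⟩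
  have hcop : m.natAbs.Coprime ((2 : ℤ) ^ k).natAbs := by
    rw [Int.natAbs_pow]
    refine Nat.Coprime.pow_right k ?_
    exact Nat.coprime_two_right.2 (Int.natAbs_odd.2 ⟨_, rfl⟩)
  have hden := Rat.den_div_eq_of_coprime (show (0 : ℤ) < 2 ^ k by positivity) hcop
  push_cast at hden
  have hden' : ((m : ℚ) / 2 ^ k).den = 2 ^ k := by exact_mod_cast hden
  simp only [hden', Nat.log_pow (Nat.lt_succ_self 1)]
  rw [hk, Nat.unpair_pair]

lemma hasColouring_real : HasColouring ℝ := by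
  classical
  obtain ⟨col, hcol⟩ := hasColouring_rat
  refine ⟨fun x => if h : ∃ q : ℚ, (q : ℝ) = x then col h.choose else 0, fun i a b hab => ?_⟩
  obtain ⟨p, hap, hpb⟩ := exists_rat_btwn hab
  obtain ⟨r, hpr, hrb⟩ := exists_rat_btwn hpb
  obtain ⟨q, h1, h2, h3⟩ := hcol i p r (by exact_mod_cast hpr)
  have hq : ∃ q' : ℚ, (q' : ℝ) = q := ⟨q, rfl⟩
  refine ⟨q, hap.trans (by exact_mod_cast h1), lt_trans (by exact_mod_cast h2) hrb, ?_⟩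
  have : hq.choose = q := by exact_mod_cast hq.choose_spec
  simp only [dif_pos hq, this, h3]

end Dense

/-! ## Finite bisimilar models -/

section BisimilarModels

open TMF

variable {𝒦 : Set KFrame} {V : Set ℕ}

lemma TMF.mem_subs_self (φ : TMF) : φ ∈ φ.subs := by
  cases φ <;> simp [TMF.subs]

lemma TMF.card_subs_le_size (φ : TMF) : φ.subs.card ≤ φ.size :=
  Finset.card_le_card Finset.subset_union_left

namespace Pt

variable (h𝒦 : ∀ F ∈ 𝒦, F.Linear)
include h𝒦

lemma Comp.exists_cover {σ : Set ℕ} {T : Pt 𝒦 Set.univ} {Tσ : Pt 𝒦 σ} (hT : restr σ T = Tσ) :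
    ∃ c : Cover (Comp.Rel (T := Tσ) true) (Comp.Rel (T := T) true),
      ∀ x, (c.s x).1 = restr σ x.1 := by
  let s : Comp T → Comp Tσ := fun x => ⟨restr σ x.1, by
    subst hT
    rcases x.2 with h | h | h
    · exact Or.inl (congrArg _ h)
    · exact Or.inr (Or.inl h.restr)
    · exact Or.inr (Or.inr h.restr)⟩
  have lift : ∀ (d : Bool) (x : Comp T) (a : Comp Tσ), Comp.Rel d (s x) a →
      ∃ y, Comp.Rel d x y ∧ s y = a := by
    intro d x a h
    obtain ⟨y, hxy, hy⟩ := exists_rel_of_restr h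
    obtain ⟨y, rfl⟩ := Comp.exists_lift h𝒦 x hxy
    exact ⟨y, hxy, Subtype.ext hy⟩
  have hs : ∀ a, ∃ x, s x = a := by
    intro a
    have hroot : s (Comp.root T) = Comp.root Tσ := Subtype.ext hT
    rcases a.2 with h | h | h
    · exact ⟨Comp.root T, hroot.trans (Subtype.ext h.symm)⟩
    · obtain ⟨y, -, hy⟩ := lift true (Comp.root T) a (by rw [hroot]; exact h)
      exact ⟨y, hy⟩
    · obtain ⟨y, -, hy⟩ := lift false (Comp.root T) a (by rw [hroot]; exact h.swap)
      exact ⟨y, hy⟩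
  have mem_of_eq : ∀ (x : Comp T) (a : Comp Tσ), s x = a → ∀ φ ∈ a.1, φ ∈ x.1 := by
    rintro x _ rfl φ hφ
    exact (mem_restr.1 hφ).1
  have last : ∀ (d : Bool) (a : Comp Tσ), ∃ y, s y = a ∧
      ∀ x, Comp.Rel d (s x) a → Comp.Rel d x y := by
    intro d a
    obtain ⟨x₀, h₀⟩ := hs a
    obtain ⟨y, hy, hlast⟩ := Comp.exists_last h𝒦 d {φ | φ ∈ a.1} x₀ (mem_of_eq _ _ h₀)
    refine ⟨y, Subtype.ext (restr_eq hy), fun x hx => ?_⟩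
    obtain ⟨z, hxz, hz⟩ := lift d x a hx
    rcases hlast z (mem_of_eq _ _ hz) with rfl | h
    · exact hxz
    · exact Comp.trans h𝒦 hxz h
  choose top htop using last true
  choose bot hbot using last false
  exact ⟨⟨s, top, bot, fun x y h => Rel.restr h, fun a => (htop a).1, fun a => (hbot a).1,
    fun x a h => (htop a).2 x h,
    fun x a h => Comp.rel_not.1 ((hbot a).2 x (Comp.rel_not.2 h))⟩, fun _ => rfl⟩

lemma Comp.exists_strict_between {bI bR : Prop}
    (hI : bI → ∀ F ∈ 𝒦, ∀ x y, F.R x y → ∃ z, F.R x z ∧ F.R z y)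
    (hR : bR → ∀ F ∈ 𝒦, ∀ (A : Set F.W) (x y : F.W), F.R x y → (∃ a ∈ A, F.R x a) →
      (¬ ∃ a ∈ A, F.R y a) → ∃ b, F.R x b ∧ (¬ ∃ a ∈ A, F.R b a) ∧
        ∀ c, F.R c b → ∃ a ∈ A, F.R c a)
    {T : Pt 𝒦 V} (x y : Comp T) (hxy : Strict (Comp.Rel true) x y)
    (hb : Bad bI bR (Comp.Rel true x x) (Comp.Rel true y y)) :
    ∃ z, Strict (Comp.Rel true) x z ∧ Strict (Comp.Rel true) z y ∧
      (Comp.Rel true z z ↔ ¬ Comp.Rel true x x) := by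
  rcases hb with ⟨h, hx, hy⟩ | ⟨h, hx, hy⟩
  · obtain ⟨z, hz, hxz, hzy⟩ := Comp.exists_refl_between h𝒦 (hI h) hxy.1
    exact ⟨z, ⟨hxz, fun h => hx (Comp.trans h𝒦 hxz h)⟩, ⟨hzy, fun h => hy (Comp.trans h𝒦 h hzy)⟩,
      iff_of_true hz hx⟩
  · obtain ⟨z, hz, hxz, hzy⟩ := Comp.exists_irrefl_between h𝒦 (hR h) hxy.1 hxy.2 hx hy
    exact ⟨z, ⟨hxz, fun h => hz (Comp.trans h𝒦 h hxz)⟩, ⟨hzy, fun h => hz (Comp.trans h𝒦 hzy h)⟩,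
      iff_of_false hz (not_not.2 hx)⟩

/-- few points suffice to witness the subformulas of `φ` and the ends of the frame -/
lemma Comp.exists_witnesses {ser : Prop} (hser : ser → ∀ d, ∀ F ∈ 𝒦, ∀ x, ∃ y, F.rel d x y)
    (T : Pt 𝒦 V) (φ : TMF) :
    ∃ B : Finset (Comp T), B.card ≤ 3 + 2 * φ.size ∧ Comp.root T ∈ B ∧
      (ser → ∀ d, ∃ e ∈ B, ∀ x, Comp.Rel d x e) ∧
      ∀ ψ ∈ φ.subs, ∀ d x, ψ ∈ x.1 → ∃ y ∈ B, ψ ∈ y.1 ∧ (x = y ∨ Comp.Rel d x y) := by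
  classical
  have hlast : ∀ (d : Bool) (ψ : TMF), ∃ y : Comp T, ∀ x : Comp T, ψ ∈ x.1 →
      ψ ∈ y.1 ∧ (x = y ∨ Comp.Rel d x y) := by
    intro d ψ
    by_cases h : ∃ x : Comp T, ψ ∈ x.1
    · obtain ⟨x₀, h₀⟩ := h
      obtain ⟨y, hy, hl⟩ := Comp.exists_last h𝒦 d {ψ} x₀ (by rintro _ rfl; exact h₀)
      exact ⟨y, fun x hx => ⟨hy ψ rfl, hl x (by rintro _ rfl; exact hx)⟩⟩
    · exact ⟨Comp.root T, fun x hx => absurd ⟨x, hx⟩ h⟩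
  choose last hlast using hlast
  have hend : ∀ d : Bool, ∃ e : Comp T, ser → ∀ x, Comp.Rel d x e := by
    intro d
    by_cases h : ser
    · obtain ⟨e, he⟩ := Comp.exists_refl_last h𝒦 d (hser h d) T
      exact ⟨e, fun _ => he⟩
    · exact ⟨Comp.root T, fun h' => absurd h' h⟩
  choose e he using hend
  refine ⟨{Comp.root T, e true, e false} ∪ (φ.subs.image (last true) ∪ φ.subs.image (last false)),
    ?_, by simp, fun h d => ⟨e d, by cases d <;> simp, he d h⟩, fun ψ hψ d x hx => ?_⟩
  · have h1 : ({Comp.root T, e true, e false} : Finset (Comp T)).card ≤ 3 := Finset.card_le_three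
    have h2 := Finset.card_union_le (φ.subs.image (last true)) (φ.subs.image (last false))
    have h3 : (φ.subs.image (last true)).card ≤ φ.subs.card := Finset.card_image_le
    have h4 : (φ.subs.image (last false)).card ≤ φ.subs.card := Finset.card_image_le
    have h5 := φ.card_subs_le_size
    refine (Finset.card_union_le _ _).trans ?_
    omega
  · refine ⟨last d ψ, Finset.mem_union_right _ ?_, hlast d ψ x hx⟩
    cases d
    · exact Finset.mem_union_right _ (Finset.mem_image_of_mem _ hψ)
    · exact Finset.mem_union_left _ (Finset.mem_image_of_mem _ hψ)

omit h𝒦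

/-- the canonical model restricted to a finite set of points -/
def Comp.model {T : Pt 𝒦 V} (W : Finset (Comp T)) : TModel W :=
  ⟨tKripke W fun x y => Comp.Rel true x.1 y.1, fun p => {x | .var p ∈ x.1.1}⟩

include h𝒦

lemma Comp.model_isModel {T : Pt 𝒦 V} {W : Finset (Comp T)} (hW : W.Nonempty) :
    (Comp.model W).IsModel :=
  ⟨⟨hW.to_subtype, fun _ _ _ h h' => Comp.trans h𝒦 h h',
    fun x y => by
      rcases Comp.conn h𝒦 true x.1 y.1 with h | h | h
      · exact Or.inl h
      · exact Or.inr (Or.inl (Subtype.ext h))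
      · exact Or.inr (Or.inr h),
    trivial, trivial, fun _ _ _ _ => trivial, fun _ _ => trivial, fun _ _ => trivial,
    fun _ _ => trivial⟩, fun _ => trivial⟩

lemma Comp.model_sat {T : Pt 𝒦 Set.univ} {W : Finset (Comp T)} {φ : TMF}
    (hW : ∀ ψ ∈ φ.subs, ∀ d x, ψ ∈ x.1 → ∃ y ∈ W, ψ ∈ y.1 ∧ (x = y ∨ Comp.Rel d x y))
    (x : W) : (Comp.model W).sat x φ ↔ φ ∈ x.1.1 := by
  have dia_iff : ∀ (d : Bool) (ψ : TMF), ψ ∈ φ.subs → ∀ x : W,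
      dia d ψ ∈ x.1.1 ↔ ∃ y : W, Comp.Rel d x.1 y.1 ∧ ψ ∈ y.1.1 := by
    intro d ψ hψ x
    constructor
    · intro h
      obtain ⟨z, hxz, hz⟩ := Comp.exists_rel_of_dia h𝒦 h
      obtain ⟨y, hy, hψy, rfl | hzy⟩ := hW ψ hψ d z hz
      · exact ⟨⟨z, hy⟩, hxz, hz⟩
      · exact ⟨⟨y, hy⟩, Comp.trans h𝒦 hxz hzy, hψy⟩
    · rintro ⟨y, hxy, hy⟩
      exact hxy ψ hy
  suffices ∀ ψ, ψ.subs ⊆ φ.subs → ∀ x : W, (Comp.model W).sat x ψ ↔ ψ ∈ x.1.1 from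
    this φ subset_rfl x
  intro ψ
  induction ψ with
  | var p => exact fun _ _ => Iff.rfl
  | top => exact fun _ x => iff_of_true trivial (mem_of_entails [] (by simp) over_univ
      fun _ _ => PModel.holds_top)
  | bot =>
    refine fun _ x => iff_of_false id fun h => ?_
    obtain ⟨u, hu⟩ := exists_holds [.bot] (by simpa using h)
    exact hu .bot (by simp)
  | neg ψ ih =>
    intro h x
    rw [mem_neg over_univ, ← ih ((Finset.subset_insert _ _).trans h)]
    rfl
  | and ψ χ ih ih' =>
    intro h x
    have h' := (Finset.subset_insert _ _).trans h
    rw [mem_and over_univ over_univ, ← ih (Finset.subset_union_left.trans h'),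
      ← ih' (Finset.subset_union_right.trans h')]
    rfl
  | diaF ψ ih =>
    intro h x
    have h' := (Finset.subset_insert _ _).trans h
    refine Iff.trans ?_ (dia_iff true ψ (h' ψ.mem_subs_self) x).symm
    exact exists_congr fun y => and_congr Iff.rfl (ih h' y)
  | diaP ψ ih =>
    intro h x
    have h' := (Finset.subset_insert _ _).trans h
    refine Iff.trans ?_ (dia_iff false ψ (h' ψ.mem_subs_self) x).symm
    exact exists_congr fun y => and_congr (Comp.rel_not (d := true)).symm (ih h' y)

omit h𝒦

lemma Comp.model_isBisim {σ : Set ℕ} {T₁ T₂ : Pt 𝒦 Set.univ} {Tσ : Pt 𝒦 σ}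
    (c₁ : Cover (Comp.Rel (T := Tσ) true) (Comp.Rel (T := T₁) true))
    (c₂ : Cover (Comp.Rel (T := Tσ) true) (Comp.Rel (T := T₂) true))
    (hc₁ : ∀ x, (c₁.s x).1 = restr σ x.1) (hc₂ : ∀ x, (c₂.s x).1 = restr σ x.1)
    {A : Finset (Comp Tσ)} {W₁ : Finset (Comp T₁)} {W₂ : Finset (Comp T₂)}
    (hs₁ : ∀ x ∈ W₁, c₁.s x ∈ A) (hs₂ : ∀ x ∈ W₂, c₂.s x ∈ A)
    (he₁ : ∀ a ∈ A, c₁.top a ∈ W₁ ∧ c₁.bot a ∈ W₁)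
    (he₂ : ∀ a ∈ A, c₂.top a ∈ W₂ ∧ c₂.bot a ∈ W₂) :
    TIsBisim σ (Comp.model W₁) (Comp.model W₂) fun x y => c₁.s x.1 = c₂.s y.1 := by
  intro x y hxy
  refine ⟨fun p hp => ?_, fun z hz => ?_, fun z hz => ?_, fun z hz => ?_, fun z hz => ?_⟩
  · have hp' : Over σ (.var p) := by simpa [Over, sig, vars] using hp
    have h : restr σ x.1.1 = restr σ y.1.1 := by rw [← hc₁, ← hc₂, hxy]
    have h1 : TMF.var p ∈ restr σ x.1.1 ↔ .var p ∈ x.1.1 := by simp [mem_restr, hp']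
    have h2 : TMF.var p ∈ restr σ y.1.1 ↔ .var p ∈ y.1.1 := by simp [mem_restr, hp']
    rw [h] at h1
    exact h1.symm.trans h2
  · refine ⟨⟨c₂.top (c₁.s z), (he₂ _ (hs₁ _ z.2)).1⟩, c₂.rel_top _ _ ?_, (c₂.s_top _).symm⟩
    rw [← hxy]
    exact c₁.mono _ _ hz
  · refine ⟨⟨c₁.top (c₂.s z), (he₁ _ (hs₂ _ z.2)).1⟩, c₁.rel_top _ _ ?_, c₁.s_top _⟩
    rw [hxy]
    exact c₂.mono _ _ hz
  · refine ⟨⟨c₂.bot (c₁.s z), (he₂ _ (hs₁ _ z.2)).2⟩, c₂.rel_bot _ _ ?_, (c₂.s_bot _).symm⟩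
    rw [← hxy]
    exact c₁.mono _ _ hz
  · refine ⟨⟨c₁.bot (c₂.s z), (he₁ _ (hs₂ _ z.2)).2⟩, c₁.rel_bot _ _ ?_, c₁.s_bot _⟩
    rw [hxy]
    exact c₂.mono _ _ hz

end Pt

/-- finite frames of the shape given by `bI`, `bR` and `ser` validate the logic of `𝒦` -/
def ValidatedByGood (𝒦 : Set KFrame) (bI bR ser : Prop) : Prop :=
  ∀ (W : Type) (R : W → W → Prop), Finite W → Nonempty W → (∀ x y z, R x y → R y z → R x z) →
    (∀ x y, R x y ∨ x = y ∨ R y x) → Good bI bR R Set.univ →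
    (ser → (∃ e, ∀ x, R x e) ∧ ∃ e, ∀ x, R e x) → (tKripke W R).IsFrameFor (logicOf 𝒦)

lemma Pt.Comp.model_isFrameFor (h𝒦 : ∀ F ∈ 𝒦, F.Linear) {bI bR ser : Prop}
    (hfin : ValidatedByGood 𝒦 bI bR ser) {T : Pt 𝒦 V} {W : Finset (Comp T)} (hW : W.Nonempty)
    (hgood : Good bI bR (Comp.Rel (T := T) true) (W : Set (Comp T)))
    (hend : ser → ∀ d, ∃ e ∈ W, ∀ x : Comp T, Comp.Rel d x e) :
    (Comp.model W).F.IsFrameFor (logicOf 𝒦) := by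
  refine hfin W _ inferInstance hW.to_subtype (fun _ _ _ h h' => Comp.trans h𝒦 h h')
    (Comp.model_isModel h𝒦 hW).1.2.2.1 ?_ fun h => ?_
  · intro x _ y _ hxy hb
    obtain ⟨z, hz, h1, h2⟩ := hgood x x.2 y y.2 hxy hb
    exact ⟨⟨z, hz⟩, trivial, h1, h2⟩
  · obtain ⟨e, he, h1⟩ := hend h true
    obtain ⟨e', he', h2⟩ := hend h false
    exact ⟨⟨⟨e, he⟩, fun x => h1 x⟩, ⟨e', he'⟩, fun x => Comp.rel_not.1 (h2 x)⟩

theorem exists_bisimilar_models (h𝒦 : ∀ F ∈ 𝒦, F.Linear) {bI bR ser : Prop}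
    (hI : bI → ∀ F ∈ 𝒦, ∀ x y, F.R x y → ∃ z, F.R x z ∧ F.R z y)
    (hR : bR → ∀ F ∈ 𝒦, ∀ (A : Set F.W) (x y : F.W), F.R x y → (∃ a ∈ A, F.R x a) →
      (¬ ∃ a ∈ A, F.R y a) → ∃ b, F.R x b ∧ (¬ ∃ a ∈ A, F.R b a) ∧
        ∀ c, F.R c b → ∃ a ∈ A, F.R c a)
    (hser : ser → ∀ d, ∀ F ∈ 𝒦, ∀ x, ∃ y, F.rel d x y) (hfin : ValidatedByGood 𝒦 bI bR ser) :
    ∃ P : Polynomial ℕ,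
      ∀ φ₁ φ₂ : TMF, TNoInterpolant (logicOf 𝒦) φ₁ φ₂ →
        ∃ (W₁ W₂ : Type) (_ : Fintype W₁) (_ : Fintype W₂)
          (M₁ : TModel W₁) (M₂ : TModel W₂) (x₁ : W₁) (x₂ : W₂),
          M₁.IsModel ∧ M₂.IsModel ∧
          M₁.F.P = Set.univ ∧ M₂.F.P = Set.univ ∧
          Fintype.card W₁ ≤ P.eval (max φ₁.size φ₂.size) ∧
          Fintype.card W₂ ≤ P.eval (max φ₁.size φ₂.size) ∧
          M₁.F.IsFrameFor (logicOf 𝒦) ∧ M₂.F.IsFrameFor (logicOf 𝒦) ∧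
          M₁.sat x₁ φ₁ ∧ M₂.sat x₂ (TMF.neg φ₂) ∧
          TBisimilar (φ₁.sig ∩ φ₂.sig) M₁ x₁ M₂ x₂ := by
  refine ⟨34 * (6 + 4 * Polynomial.X), fun φ₁ φ₂ hno => ?_⟩
  obtain ⟨T₁, T₂, hφ₁, hφ₂, hT⟩ := Pt.exists_of_noInterpolant hno
  set σ := φ₁.sig ∩ φ₂.sig
  obtain ⟨c₁, hc₁⟩ := Pt.Comp.exists_cover h𝒦 hT
  obtain ⟨c₂, hc₂⟩ := Pt.Comp.exists_cover h𝒦 (rfl : Pt.restr σ T₂ = _)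
  obtain ⟨B₁, hB₁, hroot₁, hend₁, hwit₁⟩ := Pt.Comp.exists_witnesses h𝒦 hser T₁ φ₁
  obtain ⟨B₂, hB₂, hroot₂, hend₂, hwit₂⟩ := Pt.Comp.exists_witnesses h𝒦 hser T₂ φ₂
  obtain ⟨A, W₁, W₂, hBW₁, hBW₂, hcard₁, hcard₂, hg₁, hg₂, hs₁, hs₂, he₁, he₂⟩ :=
    Cover.exists_selection (bI := bI) (bR := bR) c₁ c₂ (fun _ _ _ => Pt.Comp.trans h𝒦)
      (Pt.Comp.conn h𝒦 true) (Pt.Comp.exists_strict_between h𝒦 hI hR)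
      (fun _ _ _ => Pt.Comp.trans h𝒦) (Pt.Comp.conn h𝒦 true)
      (Pt.Comp.exists_strict_between h𝒦 hI hR) (fun _ _ _ => Pt.Comp.trans h𝒦)
      (Pt.Comp.conn h𝒦 true) (Pt.Comp.exists_strict_between h𝒦 hI hR) B₁ B₂
  have hne₁ : W₁.Nonempty := ⟨_, hBW₁ hroot₁⟩
  have hne₂ : W₂.Nonempty := ⟨_, hBW₂ hroot₂⟩
  have hP : (34 * (6 + 4 * Polynomial.X) : Polynomial ℕ).eval (max φ₁.size φ₂.size) =
      34 * (6 + 4 * max φ₁.size φ₂.size) := by simp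
  have hm₁ := le_max_left φ₁.size φ₂.size
  have hm₂ := le_max_right φ₁.size φ₂.size
  refine ⟨W₁, W₂, inferInstance, inferInstance, Pt.Comp.model W₁, Pt.Comp.model W₂,
    ⟨_, hBW₁ hroot₁⟩, ⟨_, hBW₂ hroot₂⟩, Pt.Comp.model_isModel h𝒦 hne₁,
    Pt.Comp.model_isModel h𝒦 hne₂, rfl, rfl, ?_, ?_, ?_, ?_, ?_, ?_, _,
    Pt.Comp.model_isBisim c₁ c₂ hc₁ hc₂ hs₁ hs₂ he₁ he₂, ?_⟩
  · rw [hP, Fintype.card_coe]; omega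
  · rw [hP, Fintype.card_coe]; omega
  · exact Pt.Comp.model_isFrameFor h𝒦 hfin hne₁ hg₁ fun h d =>
      (hend₁ h d).imp fun e he => ⟨hBW₁ he.1, he.2⟩
  · exact Pt.Comp.model_isFrameFor h𝒦 hfin hne₂ hg₂ fun h d =>
      (hend₂ h d).imp fun e he => ⟨hBW₂ he.1, he.2⟩
  · exact (Pt.Comp.model_sat h𝒦 (fun ψ hψ d x hx =>
      (hwit₁ ψ hψ d x hx).imp fun y hy => ⟨hBW₁ hy.1, hy.2⟩) _).2 hφ₁
  · have := (Pt.Comp.model_sat h𝒦 (fun ψ hψ d x hx =>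
      (hwit₂ ψ hψ d x hx).imp fun y hy => ⟨hBW₂ hy.1, hy.2⟩) ⟨_, hBW₂ hroot₂⟩)
    exact fun h => (Pt.mem_neg over_univ).1 hφ₂ (this.1 h)
  · exact Subtype.ext (by rw [hc₁, hc₂]; exact hT)

/-! ## The three logics -/

lemma lin_eq_logicOf : Lin = logicOf {F | Nonempty F.W ∧ F.Linear} := by
  ext φ
  exact ⟨fun h F hF => h F.W F.R hF.1 (fun _ _ _ => @hF.2.1 _ _ _) hF.2.2,
    fun h W R hW htr hcn => h ⟨W, R⟩ ⟨hW, ⟨fun _ _ _ => @htr _ _ _, hcn⟩⟩⟩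

/-- the Kripke frame of a strict linear order -/
def orderFrame (X : Type) [LinearOrder X] : KFrame := ⟨X, (· < ·)⟩

lemma orderFrame_linear (X : Type) [LinearOrder X] : (orderFrame X).Linear :=
  ⟨fun _ _ _ h h' => lt_trans (α := X) h h', fun x y => lt_trichotomy (α := X) x y⟩

lemma orderFrame_serial (X : Type) [LinearOrder X] [NoMinOrder X] [NoMaxOrder X] (d : Bool)
    (x : X) : ∃ y, (orderFrame X).rel d x y := by
  cases d
  · exact exists_lt x
  · exact exists_gt x

lemma validatedByGood_orderFrame (X : Type) [LinearOrder X] [NoMinOrder X] [NoMaxOrder X]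
    [Nonempty X] (hcol : HasColouring X) {bR : Prop} (hgap : bR ∨ HasGap X) :
    ValidatedByGood {orderFrame X} True bR True :=
  fun _ _ _ _ htr hcn hgood hend _ hφ =>
    valid_of_good hcol hgap htr hcn (hend trivial).1 (hend trivial).2 hgood (hφ _ rfl)

lemma linQ_eq_logicOf : LinQ = logicOf {orderFrame ℚ} := by
  ext φ
  exact ⟨by rintro h _ rfl; exact h, fun h => h _ rfl⟩

lemma linR_eq_logicOf : LinR = logicOf {orderFrame ℝ} := by
  ext φ
  exact ⟨by rintro h _ rfl; exact h, fun h => h _ rfl⟩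

lemma exists_lub_of_lt {A : Set ℝ} {x y : ℝ} (hx : ∃ a ∈ A, x < a)
    (hy : ¬ ∃ a ∈ A, y < a) : ∃ b, x < b ∧ (¬ ∃ a ∈ A, b < a) ∧ ∀ c, c < b → ∃ a ∈ A, c < a := by
  obtain ⟨a, ha, hxa⟩ := hx
  have hlub : IsLUB A (sSup A) := isLUB_csSup ⟨a, ha⟩
    ⟨y, fun z hz => not_lt.1 fun h => hy ⟨z, hz, h⟩⟩
  refine ⟨sSup A, hxa.trans_le (hlub.1 ha), fun ⟨z, hz, h⟩ => (hlub.1 hz).not_gt h, fun c hc => ?_⟩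
  exact (lt_isLUB_iff hlub).1 hc

end BisimilarModels

/-- each of `Lin`, `Lin_Q`, `Lin_R` has the polysize bisimilar model
property (Theorem `temp-selection`): there is a polynomial `P` such that whenever `φ₁`,
`φ₂` have no interpolant in the logic, this is witnessed by temporally σ-bisimilar
models based on temporal Kripke frames for the logic with at most
`P(max(|φ₁|,|φ₂|))` points each. -/
theorem temporal_polysize_bisimilar_model_property :
    ∀ L ∈ ({Lin, LinQ, LinR} : Set (Set TMF)),
      ∃ P : Polynomial ℕ,
        ∀ φ₁ φ₂ : TMF, TNoInterpolant L φ₁ φ₂ →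
          ∃ (W₁ W₂ : Type) (_ : Fintype W₁) (_ : Fintype W₂)
            (M₁ : TModel W₁) (M₂ : TModel W₂) (x₁ : W₁) (x₂ : W₂),
            M₁.IsModel ∧ M₂.IsModel ∧
            M₁.F.P = Set.univ ∧ M₂.F.P = Set.univ ∧
            Fintype.card W₁ ≤ P.eval (max φ₁.size φ₂.size) ∧
            Fintype.card W₂ ≤ P.eval (max φ₁.size φ₂.size) ∧
            M₁.F.IsFrameFor L ∧ M₂.F.IsFrameFor L ∧
            M₁.sat x₁ φ₁ ∧ M₂.sat x₂ (TMF.neg φ₂) ∧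
            TBisimilar (φ₁.sig ∩ φ₂.sig) M₁ x₁ M₂ x₂ := by
  rintro L (rfl | rfl | rfl)
  · rw [lin_eq_logicOf]
    exact exists_bisimilar_models (bI := False) (bR := False) (ser := False) (fun F hF => hF.2)
      False.elim False.elim False.elim fun W R _ hW htr hcn _ _ φ hφ =>
        hφ ⟨W, R⟩ ⟨hW, ⟨fun x y z => htr x y z, hcn⟩⟩
  · rw [linQ_eq_logicOf]
    refine exists_bisimilar_models (bI := True) (bR := False) (ser := True) ?_ ?_ False.elim ?_
      (validatedByGood_orderFrame ℚ hasColouring_rat (Or.inr hasGap_rat))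
    · rintro _ rfl
      exact orderFrame_linear ℚ
    · rintro - _ rfl x y h
      exact exists_between (α := ℚ) h
    · rintro - d _ rfl x
      exact orderFrame_serial ℚ d x
  · rw [linR_eq_logicOf]
    refine exists_bisimilar_models (bI := True) (bR := True) (ser := True) ?_ ?_ ?_ ?_
      (validatedByGood_orderFrame ℝ hasColouring_real (Or.inl trivial))
    · rintro _ rfl
      exact orderFrame_linear ℝ
    · rintro - _ rfl x y h
      exact exists_between (α := ℝ) h
    · rintro - _ rfl A x y - hx hy
      exact exists_lub_of_lt hx hy
    · rintro - d _ rfl x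
      exact orderFrame_serial ℝ d x
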